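/- arXiv:math/0610055 — 8 statements merged into one kernel-verified Lean document; each statement's English description precedes it below -/
import Mathlib

section
/- Let X ⊆ ℝⁿ be an open set, let 𝒩 be a continuous round cone family on X, and let {V_i} be an open cover of X. Then a subset P ⊆ X is 𝒩-invariant if and only if for every i the set P ∩ V_i is 𝒩_{V_i}-invariant as a subset of V_i (with the restricted family 𝒩_{V_i}). -/
open Set

noncomputable section

/-- `ℝⁿ`. -/
abbrev Euc (n : ℕ) : Type := EuclideanSpace ℝ (Fin n)

/-- A round cone in `ℝⁿ`: a closed convex set, stable under nonnegative scalar
multiplication, with nonempty interior, satisfying `N ∩ (-N) = {0}`. -/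
def IsRoundCone {n : ℕ} (N : Set (Euc n)) : Prop :=
  IsClosed N ∧ Convex ℝ N ∧ (∀ c : ℝ, 0 ≤ c → ∀ v ∈ N, c • v ∈ N) ∧
    (interior N).Nonempty ∧ N ∩ (-N) = {0}

/-- The fiber `𝒩ₓ` of a cone family at a point `x`. -/
def coneFiber {n : ℕ} (𝒩 : Set (Euc n × Euc n)) (x : Euc n) : Set (Euc n) :=
  {v | (x, v) ∈ 𝒩}

/-- Restriction `𝒩_V := 𝒩 ∩ (V × ℝⁿ)` of a cone family to a subset `V`. -/
def coneRestrict {n : ℕ} (𝒩 : Set (Euc n × Euc n)) (V : Set (Euc n)) :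
    Set (Euc n × Euc n) :=
  𝒩 ∩ (V ×ˢ (univ : Set (Euc n)))

/-- A continuous round cone family on `X ⊆ ℝⁿ`. -/
structure IsConeFam {n : ℕ} (X : Set (Euc n)) (𝒩 : Set (Euc n × Euc n)) : Prop where
  subset : 𝒩 ⊆ X ×ˢ (univ : Set (Euc n))
  closed : ∃ C : Set (Euc n × Euc n), IsClosed C ∧ 𝒩 = C ∩ (X ×ˢ (univ : Set (Euc n)))
  cone : ∀ x ∈ X, IsRoundCone (coneFiber 𝒩 x)
  lsc : ∀ x ∈ X, ∀ v ∈ interior (coneFiber 𝒩 x),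
    ∃ V : Set (Euc n), IsOpen V ∧ x ∈ V ∧ V ⊆ X ∧ ∀ y ∈ V, v ∈ interior (coneFiber 𝒩 y)

/-- A C¹ arc in `X`, given by `γ` together with its derivative `γ'` on `[0,1]`. -/
structure IsC1ArcIn {n : ℕ} (X : Set (Euc n)) (γ γ' : ℝ → Euc n) : Prop where
  maps : ∀ t ∈ Icc (0:ℝ) 1, γ t ∈ X
  deriv : ∀ t ∈ Icc (0:ℝ) 1, HasDerivWithinAt γ (γ' t) (Icc (0:ℝ) 1) t
  cont : ContinuousOn γ' (Icc (0:ℝ) 1)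

/-- `P ⊆ X` is `𝒩`-invariant: every C¹ arc starting in `P` whose velocity lies in
`𝒩_{γ(t)} \ {0}` stays in `P`. -/
def NInvariant {n : ℕ} (X : Set (Euc n)) (𝒩 : Set (Euc n × Euc n))
    (P : Set (Euc n)) : Prop :=
  ∀ γ γ' : ℝ → Euc n, IsC1ArcIn X γ γ' → γ 0 ∈ P →
    (∀ t ∈ Icc (0:ℝ) 1, γ' t ∈ coneFiber 𝒩 (γ t) \ {0}) →
    ∀ t ∈ Icc (0:ℝ) 1, γ t ∈ P

/-- `𝒩`-open subsets of `X`: open and `𝒩`-invariant. -/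
def NOpen {n : ℕ} (X : Set (Euc n)) (𝒩 : Set (Euc n × Euc n)) (U : Set (Euc n)) : Prop :=
  U ⊆ X ∧ IsOpen U ∧ NInvariant X 𝒩 U

/-- An `𝒩`-smooth function on `V`: a C¹ function with `df_x(τ) < 0` for all
`τ ∈ 𝒩ₓ \ {0}`, `x ∈ V`. -/
def NSmoothOn {n : ℕ} (𝒩 : Set (Euc n × Euc n)) (f : Euc n → ℝ) (V : Set (Euc n)) : Prop :=
  ∃ df : Euc n → (Euc n →L[ℝ] ℝ), ContinuousOn df V ∧ (∀ x ∈ V, HasFDerivAt f (df x) x) ∧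
    ∀ x ∈ V, ∀ τ ∈ coneFiber 𝒩 x \ {0}, df x τ < 0

/-- `P` is `𝒩`-small: some open neighborhood of `P` in `X` admits an `𝒩`-smooth function. -/
def NSmall {n : ℕ} (X : Set (Euc n)) (𝒩 : Set (Euc n × Euc n)) (P : Set (Euc n)) : Prop :=
  ∃ (W : Set (Euc n)) (f : Euc n → ℝ), IsOpen W ∧ P ⊆ W ∧ W ⊆ X ∧ NSmoothOn 𝒩 f W

/-- `Z ⊆ X` is `𝒩`-special: every point of the closure of `Z` in `X` has an open
neighborhood `V ⊆ X` on which, for some continuous round cone family `𝒩'` with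
`𝒩_V ⋐ 𝒩'`, the set `Z ∩ V` is locally closed in the `𝒩'`-topology of `V`. -/
def NSpecial {n : ℕ} (X : Set (Euc n)) (𝒩 : Set (Euc n × Euc n)) (Z : Set (Euc n)) : Prop :=
  Z ⊆ X ∧ ∀ x ∈ closure Z ∩ X, ∃ (V : Set (Euc n)) (𝒩' : Set (Euc n × Euc n)),
    IsOpen V ∧ x ∈ V ∧ V ⊆ X ∧ IsConeFam V 𝒩' ∧
    (∀ y ∈ V, coneFiber (coneRestrict 𝒩 V) y \ {0} ⊆ interior (coneFiber 𝒩' y)) ∧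
    ∃ U₁ U₂ : Set (Euc n), NOpen V 𝒩' U₁ ∧ NOpen V 𝒩' U₂ ∧ Z ∩ V = U₁ \ U₂

/-- An `𝒩`-lens: an `𝒩`-special subset whose closure in `X` is compact and `𝒩`-small. -/
def NLens {n : ℕ} (X : Set (Euc n)) (𝒩 : Set (Euc n × Euc n)) (Z : Set (Euc n)) : Prop :=
  NSpecial X 𝒩 Z ∧ IsCompact (closure Z ∩ X) ∧ NSmall X 𝒩 (closure Z ∩ X)

/-- A (finite) partition of a subset `S`: finitely many pairwise disjoint nonempty
subsets with union `S`. -/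
def IsPartitionOf {α : Type*} (S : Set α) (Ps : Set (Set α)) : Prop :=
  Ps.Finite ∧ (∀ A ∈ Ps, A.Nonempty) ∧
    (∀ A ∈ Ps, ∀ B ∈ Ps, A ≠ B → Disjoint A B) ∧ ⋃₀ Ps = S

/-- A partition of `S` comes from a closed filtration: there is a chain
`∅ = F₀ ⊆ … ⊆ F_m = S` of subsets closed in `S` whose nonempty successive
differences are exactly the members of the partition. -/
def ComesFromClosedFiltration {α : Type*} [TopologicalSpace α] (S : Set α)
    (Ps : Set (Set α)) : Prop :=
  ∃ (m : ℕ) (F : ℕ → Set α), F 0 = ∅ ∧ F m = S ∧ (∀ i < m, F i ⊆ F (i + 1)) ∧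
    (∀ i ≤ m, ∃ C : Set α, IsClosed C ∧ F i = C ∩ S) ∧
    Ps = {A | A.Nonempty ∧ ∃ i, 1 ≤ i ∧ i ≤ m ∧ A = F i \ F (i - 1)}

/-- An `𝒩`-special partition of an `𝒩`-lens `Z`: it comes from a closed filtration
of `Z` and each member is an `𝒩`-lens. -/
def NSpecialPartition {n : ℕ} (X : Set (Euc n)) (𝒩 : Set (Euc n × Euc n))
    (Z : Set (Euc n)) (Ps : Set (Set (Euc n))) : Prop :=
  IsPartitionOf Z Ps ∧ ComesFromClosedFiltration Z Ps ∧ ∀ A ∈ Ps, NLens X 𝒩 A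

/-- `𝒩`-constructible subsets: the smallest collection containing all `𝒩`-lenses and
stable under finite unions, intersections and differences. -/
inductive NConstructible {n : ℕ} (X : Set (Euc n)) (𝒩 : Set (Euc n × Euc n)) :
    Set (Euc n) → Prop
  | lens (Z : Set (Euc n)) : NLens X 𝒩 Z → NConstructible X 𝒩 Z
  | union (A B : Set (Euc n)) :
      NConstructible X 𝒩 A → NConstructible X 𝒩 B → NConstructible X 𝒩 (A ∪ B)
  | inter (A B : Set (Euc n)) :
      NConstructible X 𝒩 A → NConstructible X 𝒩 B → NConstructible X 𝒩 (A ∩ B)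
  | diff (A B : Set (Euc n)) :
      NConstructible X 𝒩 A → NConstructible X 𝒩 B → NConstructible X 𝒩 (A \ B)

/-- Membership in `Par^≺(Y)`: a partition of `Y` all of whose members are `𝒩`-lenses. -/
def ParPrec {n : ℕ} (X : Set (Euc n)) (𝒩 : Set (Euc n × Euc n)) (Y : Set (Euc n))
    (Ps : Set (Set (Euc n))) : Prop :=
  IsPartitionOf Y Ps ∧ ∀ A ∈ Ps, NLens X 𝒩 A

/-- The relation `⪯` on `Par^≺(Y)`: `Ps ⪯ Qs` if `Qs` refines `Ps` and for each member
`A` of `Ps` the members of `Qs` contained in `A` form an `𝒩`-special partition of `A`. -/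
def PrecRel {n : ℕ} (X : Set (Euc n)) (𝒩 : Set (Euc n × Euc n))
    (Ps Qs : Set (Set (Euc n))) : Prop :=
  (∀ B ∈ Qs, ∃ A ∈ Ps, B ⊆ A) ∧
    ∀ A ∈ Ps, NSpecialPartition X 𝒩 A {B | B ∈ Qs ∧ B ⊆ A}
theorem coneFiber_coneRestrict {n : ℕ} (𝒩 : Set (Euc n × Euc n)) {V : Set (Euc n)} {x : Euc n}
    (hx : x ∈ V) : coneFiber (coneRestrict 𝒩 V) x = coneFiber 𝒩 x := by
  ext v
  simp [coneFiber, coneRestrict, hx]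

/-- Restriction of a C¹ arc to a subinterval, affinely reparametrized by `[0,1]`. -/
theorem IsC1ArcIn.comp_affine {n : ℕ} {X V : Set (Euc n)} {γ γ' : ℝ → Euc n}
    (hγ : IsC1ArcIn X γ γ') {a b : ℝ} (ha : 0 ≤ a) (hab : a ≤ b) (hb : b ≤ 1)
    (hV : ∀ t ∈ Icc a b, γ t ∈ V) :
    IsC1ArcIn V (fun s => γ (a + (b - a) * s)) (fun s => (b - a) • γ' (a + (b - a) * s)) := by
  have hmaps : MapsTo (fun s : ℝ => a + (b - a) * s) (Icc 0 1) (Icc a b) := fun s hs =>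
    ⟨by nlinarith [hs.1, hs.2], by nlinarith [hs.1, hs.2]⟩
  have hmaps' : MapsTo (fun s : ℝ => a + (b - a) * s) (Icc 0 1) (Icc 0 1) :=
    hmaps.mono_right (Icc_subset_Icc ha hb)
  refine ⟨fun s hs => hV _ (hmaps hs), fun s hs => ?_, ?_⟩
  · have hd : HasDerivWithinAt (fun s : ℝ => a + (b - a) * s) (b - a) (Icc 0 1) s := by
      simpa using (((hasDerivAt_id s).const_mul (b - a)).const_add a).hasDerivWithinAt
    exact (hγ.deriv _ (hmaps' hs)).scomp s hd hmaps'
  · exact (hγ.cont.comp (by fun_prop) hmaps').const_smul (b - a)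

/-- An arc segment lying in `V` and starting in an invariant subset of `V` stays there. -/
theorem NInvariant.mem_of_segment {n : ℕ} {X V P : Set (Euc n)} {𝒩 : Set (Euc n × Euc n)}
    (hP : NInvariant V (coneRestrict 𝒩 V) (P ∩ V)) {γ γ' : ℝ → Euc n}
    (hγ : IsC1ArcIn X γ γ')
    (hcone : ∀ x ∈ X, ∀ c : ℝ, 0 ≤ c → ∀ v ∈ coneFiber 𝒩 x, c • v ∈ coneFiber 𝒩 x)
    (hγ' : ∀ t ∈ Icc (0 : ℝ) 1, γ' t ∈ coneFiber 𝒩 (γ t) \ {0})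
    {a b : ℝ} (ha : 0 ≤ a) (hb : b ≤ 1) (hV : ∀ t ∈ Icc a b, γ t ∈ V) (haP : γ a ∈ P) :
    ∀ t ∈ Icc a b, γ t ∈ P := by
  intro t ht
  obtain rfl | hlt := (ht.1.trans ht.2).eq_or_lt
  · rwa [le_antisymm ht.2 ht.1]
  have hpos : 0 < b - a := sub_pos.mpr hlt
  have harc := hγ.comp_affine ha hlt.le hb hV
  have key := hP _ _ harc ⟨by simpa using haP, harc.maps 0 (by simp)⟩ (fun s hs => by
    have hs' : a + (b - a) * s ∈ Icc (0 : ℝ) 1 :=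
      ⟨by nlinarith [hs.1, hs.2], by nlinarith [hs.1, hs.2]⟩
    rw [coneFiber_coneRestrict 𝒩 (harc.maps s hs)]
    exact ⟨hcone _ (hγ.maps _ hs') _ hpos.le _ (hγ' _ hs').1,
      smul_ne_zero hpos.ne' (hγ' _ hs').2⟩) ((t - a) / (b - a))
    ⟨div_nonneg (sub_nonneg.mpr ht.1) hpos.le, (div_le_one hpos).mpr (by linarith [ht.2])⟩
  have heq : a + (b - a) * ((t - a) / (b - a)) = t := by field_simp; ring
  simpa only [heq] using key.1

/-- `𝒩`-invariance is a local property with respect to any open cover. -/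
theorem stmt_0 {n : ℕ} (X : Set (Euc n)) (hX : IsOpen X)
    (𝒩 : Set (Euc n × Euc n)) (h𝒩 : IsConeFam X 𝒩)
    {ι : Type*} (V : ι → Set (Euc n)) (hVopen : ∀ i, IsOpen (V i))
    (hVsub : ∀ i, V i ⊆ X) (hcov : X ⊆ ⋃ i, V i)
    (P : Set (Euc n)) (hP : P ⊆ X) :
    NInvariant X 𝒩 P ↔
      ∀ i, NInvariant (V i) (coneRestrict 𝒩 (V i)) (P ∩ V i) := by
  constructor
  · intro h i γ γ' hγ h0 hγ' t ht
    refine ⟨h γ γ' ⟨fun s hs => hVsub i (hγ.maps s hs), hγ.deriv, hγ.cont⟩ h0.1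
      (fun s hs => ?_) t ht, hγ.maps t ht⟩
    simpa only [coneFiber_coneRestrict 𝒩 (hγ.maps s hs)] using hγ' s hs
  · intro h γ γ' hγ h0 hγ'
    have hcont : Continuous fun t : Icc (0 : ℝ) 1 => γ t :=
      continuousOn_iff_continuous_domRestrict.mp fun t ht => (hγ.deriv t ht).continuousWithinAt
    obtain ⟨τ, hτ0, -, ⟨m, hm⟩, hτV⟩ := exists_monotone_Icc_subset_open_cover_Icc
      (zero_le_one' ℝ) (c := fun i => {t : Icc (0 : ℝ) 1 | γ t ∈ V i})
      (fun i => (hVopen i).preimage hcont)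
      (fun t _ => by simpa using hcov (hγ.maps t t.2))
    have hstep : ∀ k, ∀ t ∈ Icc (0 : ℝ) (τ k), γ t ∈ P := by
      intro k
      induction k with
      | zero =>
        intro t ht
        rw [hτ0] at ht
        rwa [le_antisymm ht.2 ht.1]
      | succ k ih =>
        intro t ht
        obtain htk | htk := le_total t (τ k)
        · exact ih t ⟨ht.1, htk⟩
        obtain ⟨i, hi⟩ := hτV k
        refine (h i).mem_of_segment hγ (fun x hx => (h𝒩.cone x hx).2.2.1) hγ'
          (τ k).2.1 (τ (k + 1)).2.2 (fun s hs => ?_) (ih _ ⟨(τ k).2.1, le_rfl⟩) t ⟨htk, ht.2⟩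
        exact @hi ⟨s, (τ k).2.1.trans hs.1, hs.2.trans (τ (k + 1)).2.2⟩ hs
    intro t ht
    refine hstep m t ?_
    rwa [hm m le_rfl]
end
end

section
/- Let X ⊆ ℝⁿ be an open set and let 𝒩 be a continuous round cone family on X. If P ⊆ X is 𝒩-invariant, then for every C¹-arc γ : [0,1] → X with γ(0) in the closure of P in X and with γ′(t) ∈ interior(𝒩_{γ(t)}) for all t ∈ [0,1], one has γ((0,1]) ⊆ interior(P). -/
open Set

noncomputable section

open Topology

/-- The interiors of the fibers of a continuous round cone family form an open set. -/
lemma IsConeFam.isOpen_interior_coneFiber {n : ℕ} {X : Set (Euc n)} {𝒩 : Set (Euc n × Euc n)}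
    (h : IsConeFam X 𝒩) :
    IsOpen {z : Euc n × Euc n | z.1 ∈ X ∧ z.2 ∈ interior (coneFiber 𝒩 z.1)} := by
  rw [isOpen_iff_mem_nhds]
  rintro ⟨x, v⟩ ⟨hx, hv⟩
  obtain ⟨b, hvb, hb⟩ :=
    exists_mem_interior_convexHull_affineBasis (isOpen_interior.mem_nhds hv)
  have hV : ∀ i, ∀ᶠ y in 𝓝 x, y ∈ X ∧ b i ∈ interior (coneFiber 𝒩 y) := by
    intro i
    obtain ⟨V, hVo, hxV, hVX, hV⟩ :=
      h.lsc x hx (b i) (hb (subset_convexHull ℝ _ (mem_range_self i)))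
    filter_upwards [hVo.mem_nhds hxV] with y hy using ⟨hVX hy, hV y hy⟩
  have hb_near : ∀ᶠ y in 𝓝 x, ∀ i, y ∈ X ∧ b i ∈ interior (coneFiber 𝒩 y) :=
    Filter.eventually_all.2 hV
  filter_upwards [prod_mem_nhds hb_near (isOpen_interior.mem_nhds hvb)]
  rintro ⟨y, w⟩ ⟨hy, hw⟩
  have hyX : y ∈ X := (hy 0).1
  refine ⟨hyX, interior_mono (convexHull_min ?_ (h.cone y hyX).2.1) hw⟩
  rintro _ ⟨i, rfl⟩
  exact interior_subset (hy i).2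

lemma IsRoundCone.smul_mem_interior {n : ℕ} {N : Set (Euc n)} (hN : IsRoundCone N) {c : ℝ}
    (hc : 0 < c) {v : Euc n} (hv : v ∈ interior N) : c • v ∈ interior N := by
  have hsub : (fun w : Euc n ↦ c • w) '' interior N ⊆ N := by
    rintro _ ⟨w, hw, rfl⟩
    exact hN.2.2.1 c hc.le w (interior_subset hw)
  exact interior_maximal hsub (isOpenMap_smul₀ hc.ne' _ isOpen_interior) (mem_image_of_mem _ hv)

lemma IsRoundCone.zero_notMem_interior {n : ℕ} [Nontrivial (Euc n)] {N : Set (Euc n)}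
    (hN : IsRoundCone N) : (0 : Euc n) ∉ interior N := by
  intro h0
  have hN0 : N ∈ 𝓝 (0 : Euc n) := mem_interior_iff_mem_nhds.1 h0
  have hmem : ∀ v : Euc n, v ∈ N := by
    intro v
    obtain ⟨c, hcN, hc⟩ : ∃ c : ℝ, c • v ∈ N ∧ 0 < c := by
      have hlim : Filter.Tendsto (fun c : ℝ ↦ c • v) (𝓝[>] 0) (𝓝 0) := by
        have : Filter.Tendsto (fun c : ℝ ↦ c • v) (𝓝 0) (𝓝 ((0 : ℝ) • v)) :=
          (continuous_id.smul continuous_const).tendsto 0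
        rw [zero_smul] at this
        exact this.mono_left nhdsWithin_le_nhds
      exact ((hlim.eventually hN0).and self_mem_nhdsWithin).exists
    simpa [smul_smul, hc.ne'] using hN.2.2.1 c⁻¹ (inv_nonneg.2 hc.le) _ hcN
  obtain ⟨v, hv⟩ := exists_ne (0 : Euc n)
  have hv0 : v ∈ N ∩ -N := ⟨hmem v, hmem (-v)⟩
  rw [hN.2.2.2.2] at hv0
  exact hv hv0

/-- Rescaling an arc to `[0, t]` and adding an affine perturbation gives a C¹ arc. -/
lemma IsC1ArcIn.comp_mul_add_affine {n : ℕ} {X : Set (Euc n)} {γ γ' : ℝ → Euc n}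
    (hγ : IsC1ArcIn X γ γ') {t : ℝ} (ht : t ∈ Icc (0 : ℝ) 1) (a e : Euc n)
    {Y : Set (Euc n)} (hY : ∀ s ∈ Icc (0 : ℝ) 1, γ (t * s) + (a + s • e) ∈ Y) :
    IsC1ArcIn Y (fun s ↦ γ (t * s) + (a + s • e)) (fun s ↦ t • γ' (t * s) + e) := by
  have hmaps : MapsTo (fun s : ℝ ↦ t * s) (Icc 0 1) (Icc 0 1) := fun s hs ↦
    ⟨mul_nonneg ht.1 hs.1, mul_le_one₀ ht.2 hs.1 hs.2⟩
  refine ⟨hY, fun s hs ↦ ?_, ?_⟩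
  · have hmul : HasDerivWithinAt (fun s : ℝ ↦ t * s) t (Icc 0 1) s := by
      simpa using (hasDerivWithinAt_id s (Icc (0 : ℝ) 1)).const_mul t
    have hlin : HasDerivWithinAt (fun s : ℝ ↦ a + s • e) e (Icc 0 1) s := by
      simpa using ((hasDerivWithinAt_id s (Icc (0 : ℝ) 1)).smul_const e).const_add a
    exact ((hγ.deriv _ (hmaps hs)).scomp s hmul hmaps).add hlin
  · exact ((hγ.cont.comp (by fun_prop) hmaps).const_smul t).add continuousOn_const

/-- an arc starting in the closure of an `𝒩`-invariant set `P`, with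
velocity in the interior of the cones, lands in the interior of `P` for `t > 0`. -/
theorem stmt_2 {n : ℕ} (X : Set (Euc n)) (hX : IsOpen X)
    (𝒩 : Set (Euc n × Euc n)) (h𝒩 : IsConeFam X 𝒩)
    (P : Set (Euc n)) (hP : P ⊆ X) (hinv : NInvariant X 𝒩 P)
    (γ γ' : ℝ → Euc n) (hγ : IsC1ArcIn X γ γ') (h0 : γ 0 ∈ closure P ∩ X)
    (hder : ∀ t ∈ Icc (0:ℝ) 1, γ' t ∈ interior (coneFiber 𝒩 (γ t))) :
    ∀ t ∈ Ioc (0:ℝ) 1, γ t ∈ interior P := by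
  rintro t ⟨ht0, ht1⟩
  have ht : t ∈ Icc (0 : ℝ) 1 := ⟨ht0.le, ht1⟩
  obtain ⟨p₀, hp₀⟩ : P.Nonempty := closure_nonempty_iff.1 ⟨_, h0.1⟩
  rcases subsingleton_or_nontrivial (Euc n) with hsub | hnontriv
  · rw [Subsingleton.eq_univ_of_nonempty ⟨p₀, hp₀⟩, interior_univ]
    exact mem_univ _
  have hmaps : MapsTo (fun s : ℝ ↦ t * s) (Icc 0 1) (Icc 0 1) := fun s hs ↦
    ⟨mul_nonneg ht0.le hs.1, mul_le_one₀ ht1 hs.1 hs.2⟩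
  have hγc : ContinuousOn γ (Icc 0 1) := fun s hs ↦ (hγ.deriv s hs).continuousWithinAt
  have hmul : ContinuousOn (fun s : ℝ ↦ t * s) (Icc 0 1) := by fun_prop
  have hK : IsCompact ((fun s : ℝ ↦ (γ (t * s), t • γ' (t * s))) '' Icc 0 1) :=
    isCompact_Icc.image_of_continuousOn
      ((hγc.comp hmul hmaps).prodMk ((hγ.cont.comp hmul hmaps).const_smul t))
  obtain ⟨ε, hε, hthick⟩ := hK.exists_thickening_subset_open h𝒩.isOpen_interior_coneFiber (by
    rintro _ ⟨s, hs, rfl⟩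
    have hX' := hγ.maps _ (hmaps hs)
    exact ⟨hX', (h𝒩.cone _ hX').smul_mem_interior ht0 (hder _ (hmaps hs))⟩)
  obtain ⟨p, hp, hdist⟩ := Metric.mem_closure_iff.1 h0.1 (ε / 3) (by positivity)
  rw [dist_eq_norm, norm_sub_rev] at hdist
  rw [mem_interior_iff_mem_nhds]
  filter_upwards [Metric.ball_mem_nhds (γ t) (show 0 < ε / 3 by positivity)] with q hq
  rw [Metric.mem_ball, dist_eq_norm] at hq
  set a : Euc n := p - γ 0 with ha
  set e : Euc n := (q - γ t) - a with he
  have he_norm : ‖e‖ < 2 * (ε / 3) := (norm_sub_le _ _).trans_lt (by linarith)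
  have hmem : ∀ s ∈ Icc (0 : ℝ) 1, γ (t * s) + (a + s • e) ∈ X ∧
      t • γ' (t * s) + e ∈ interior (coneFiber 𝒩 (γ (t * s) + (a + s • e))) := by
    intro s hs
    refine @hthick (_, _) (Metric.mem_thickening_iff.2 ⟨_, mem_image_of_mem _ hs, ?_⟩)
    have hse : ‖s • e‖ ≤ ‖e‖ := by
      rw [norm_smul, Real.norm_of_nonneg hs.1]
      exact mul_le_of_le_one_left (norm_nonneg _) hs.2
    rw [Prod.dist_eq, dist_eq_norm, dist_eq_norm, add_sub_cancel_left, add_sub_cancel_left]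
    exact max_lt ((norm_add_le _ _).trans_lt (by linarith)) (by linarith)
  have hend := hinv _ _ (hγ.comp_mul_add_affine ht a e fun s hs ↦ (hmem s hs).1)
    (by simpa [ha] using hp)
    (fun s hs ↦ ⟨interior_subset (hmem s hs).2, fun hzero ↦
      (h𝒩.cone _ (hmem s hs).1).zero_notMem_interior
        ((mem_singleton_iff.1 hzero) ▸ (hmem s hs).2)⟩)
    1 (right_mem_Icc.2 zero_le_one)
  simpa [he] using hend
end
end

section
/- Let X ⊆ ℝⁿ be an open set and let 𝒩 be a continuous round cone family on X. If P ⊆ X is 𝒩-invariant, then interior(P) equals the interior of the closure of P in X, and interior(P) is dense in P, i.e. P is contained in the closure of interior(P). -/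
open Set

noncomputable section

open Filter Topology in
/-- Near a point of `X` there is a nonempty open set `U` of nonzero directions belonging to all the
nearby fibers. -/
theorem IsConeFam.exists_open_directions {n : ℕ} [Nontrivial (Euc n)] {X : Set (Euc n)}
    (hX : IsOpen X) {𝒩 : Set (Euc n × Euc n)} (h𝒩 : IsConeFam X 𝒩) {x : Euc n} (hx : x ∈ X) :
    ∃ δ > 0, ∃ U : Set (Euc n), IsOpen U ∧ U.Nonempty ∧ Metric.ball x δ ⊆ X ∧
      ∀ y ∈ Metric.ball x δ, U ⊆ coneFiber 𝒩 y \ {0} := by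
  obtain ⟨v, hv⟩ := (h𝒩.cone x hx).2.2.2.1
  obtain ⟨b, hvb, hb⟩ := exists_mem_interior_convexHull_affineBasis
    (isOpen_interior.mem_nhds hv)
  have hnear : ∀ᶠ y in 𝓝 x, y ∈ X ∧ ∀ i, b i ∈ coneFiber 𝒩 y := by
    refine (hX.eventually_mem hx).and (eventually_all.2 fun i => ?_)
    obtain ⟨V, hV, hxV, -, h⟩ := h𝒩.lsc x hx (b i) (hb (subset_convexHull ℝ _ (mem_range_self i)))
    filter_upwards [hV.mem_nhds hxV] with y hy
    exact interior_subset (h y hy)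
  obtain ⟨δ, hδ, hball⟩ := Metric.eventually_nhds_iff_ball.1 hnear
  refine ⟨δ, hδ, interior (convexHull ℝ (range b)) ∩ {0}ᶜ,
    isOpen_interior.inter isOpen_compl_singleton, ?_, fun y hy => (hball y hy).1, ?_⟩
  · exact (dense_compl_singleton (0 : Euc n)).inter_open_nonempty _ isOpen_interior ⟨v, hvb⟩
  · rintro y hy u ⟨hu, hu0⟩
    obtain ⟨hyX, hby⟩ := hball y hy
    exact ⟨convexHull_min (range_subset_iff.2 hby) (h𝒩.cone y hyX).2.1 (interior_subset hu), hu0⟩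

/-- An invariant set contains the endpoint of a segment issued from one of its points, as soon
as the direction of the segment lies in all the fibers along it. -/
theorem NInvariant.mem_of_segment_s3 {n : ℕ} {X : Set (Euc n)} {𝒩 : Set (Euc n × Euc n)}
    {P : Set (Euc n)} (hinv : NInvariant X 𝒩 P) (h𝒩 : IsConeFam X 𝒩) {B : Set (Euc n)}
    (hB : Convex ℝ B) (hBX : B ⊆ X) {p w : Euc n} {t : ℝ} (ht : 0 < t) (hp : p ∈ P)
    (hpB : p ∈ B) (hB' : p + t • w ∈ B) (hw : ∀ y ∈ B, w ∈ coneFiber 𝒩 y \ {0}) :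
    p + t • w ∈ P := by
  have hmem : ∀ s ∈ Icc (0 : ℝ) 1, p + s • t • w ∈ B := fun s hs =>
    hB.add_smul_mem hpB hB' hs
  have key := hinv (fun s => p + s • t • w) (fun _ => t • w)
    ⟨fun s hs => hBX (hmem s hs), fun s _ => ?_, continuousOn_const⟩ (by simpa using hp)
    (fun s hs => ?_) 1 (by simp)
  · simpa using key
  · simpa using (((hasDerivAt_id s).smul_const (t • w)).const_add p).hasDerivWithinAt
  · obtain ⟨hw1, hw0⟩ := hw _ (hmem s hs)
    exact ⟨(h𝒩.cone _ (hBX (hmem s hs))).2.2.1 t ht.le w hw1, smul_ne_zero ht.ne' hw0⟩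

open Filter Topology in
/-- for an `𝒩`-invariant `P`, `Int(P) = Int(closure of P in X)` and
`Int(P)` is dense in `P`. -/
theorem stmt_3 {n : ℕ} (X : Set (Euc n)) (hX : IsOpen X)
    (𝒩 : Set (Euc n × Euc n)) (h𝒩 : IsConeFam X 𝒩)
    (P : Set (Euc n)) (hP : P ⊆ X) (hinv : NInvariant X 𝒩 P) :
    interior P = interior (closure P ∩ X) ∧ P ⊆ closure (interior P) := by
  rcases subsingleton_or_nontrivial (Euc n) with _ | _
  · simp [(isOpen_discrete _ : IsOpen P).interior_eq, inter_eq_left.2 hP]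
  have key : ∀ x ∈ X, ∃ δ > 0, ∃ v : Euc n, ∃ U : Set (Euc n), IsOpen U ∧ v ∈ U ∧
      ∀ p ∈ P, p ∈ Metric.ball x δ → ∀ y ∈ Metric.ball x δ, ∀ t : ℝ, 0 < t →
        t⁻¹ • (y - p) ∈ U → y ∈ P := by
    intro x hx
    obtain ⟨δ, hδ, U, hU, ⟨v, hv⟩, hBX, hUN⟩ := h𝒩.exists_open_directions hX hx
    refine ⟨δ, hδ, v, U, hU, hv, fun p hp hpB y hy t ht hyU => ?_⟩
    have hend : p + t • t⁻¹ • (y - p) = y := by rw [smul_inv_smul₀ ht.ne']; abel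
    have := hinv.mem_of_segment_s3 h𝒩 (convex_ball x δ) hBX ht hp hpB
      (by rwa [hend]) (fun z hz => hUN z hz hyU)
    rwa [hend] at this
  have hlim : ∀ x v : Euc n, Tendsto (fun t : ℝ => x + t • v) (𝓝[>] 0) (𝓝 x) := by
    intro x v
    have : Continuous fun t : ℝ => x + t • v := by fun_prop
    simpa using (this.tendsto 0).mono_left nhdsWithin_le_nhds
  have hopen : ∀ (p : Euc n) (t : ℝ) (U : Set (Euc n)), IsOpen U →
      IsOpen {y : Euc n | t⁻¹ • (y - p) ∈ U} := fun p t U hU =>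
    hU.preimage (by fun_prop)
  refine ⟨(interior_mono (subset_inter subset_closure hP)).antisymm fun x hx => ?_,
    fun x hx => ?_⟩
  · obtain ⟨δ, hδ, v, U, hU, hv, h⟩ := key x (interior_subset hx).2
    obtain ⟨t, ⟨htI, htB⟩, ht⟩ := (((hlim x (-v)).eventually
      ((isOpen_interior.eventually_mem hx).and (Metric.ball_mem_nhds x hδ))).and
        self_mem_nhdsWithin).exists
    have hcl : x + t • -v ∈ closure P := (interior_subset htI).1
    have hO : IsOpen ({p : Euc n | t⁻¹ • (x - p) ∈ U} ∩ Metric.ball x δ) :=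
      (hU.preimage (by fun_prop)).inter Metric.isOpen_ball
    obtain ⟨p, ⟨hpU, hpB⟩, hp⟩ := mem_closure_iff.1 hcl _ hO
      ⟨by simpa [inv_smul_smul₀ ht.ne'] using hv, htB⟩
    exact mem_interior.2 ⟨_, fun y hy => h p hp hpB y hy.2 t ht hy.1,
      (hopen p t U hU).inter Metric.isOpen_ball, hpU, Metric.mem_ball_self hδ⟩
  · obtain ⟨δ, hδ, v, U, hU, hv, h⟩ := key x (hP hx)
    refine mem_closure_of_tendsto (hlim x v) ?_
    filter_upwards [(hlim x v).eventually (Metric.ball_mem_nhds x hδ), self_mem_nhdsWithin]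
      with t htB ht
    exact mem_interior.2 ⟨_, fun y hy => h x hx (Metric.mem_ball_self hδ) y hy.2 t ht hy.1,
      (hopen x t U hU).inter Metric.isOpen_ball,
      by simpa [inv_smul_smul₀ (mem_Ioi.1 ht).ne'] using hv, htB⟩
end
end

section
/- Let X ⊆ ℝⁿ be an open set and let 𝒩 be a continuous round cone family on X. If P, Q ⊆ X are 𝒩-invariant, then the closure of P ∩ Q in X equals (closure of P in X) ∩ (closure of Q in X). -/
open Set

noncomputable section

open Filter Topology in
/-- Near a point of `X`, the fibers of a cone family contain a common ball. -/
theorem IsConeFam.exists_ball_subset_coneFiber {n : ℕ} {X : Set (Euc n)}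
    {𝒩 : Set (Euc n × Euc n)} (h𝒩 : IsConeFam X 𝒩) {x : Euc n} (hx : x ∈ X) :
    ∃ (v : Euc n) (r : ℝ), 0 < r ∧
      ∀ᶠ y in 𝓝 x, y ∈ X ∧ Metric.ball v r ⊆ coneFiber 𝒩 y := by
  obtain ⟨v, hv⟩ := (h𝒩.cone x hx).2.2.2.1
  obtain ⟨u, hvu, hu⟩ := Convex.exists_subset_interior_convexHull_finset_of_isCompact
    (convex_singleton (𝕜 := ℝ) v)
    isCompact_singleton (mem_nhdsSet_iff_exists.2
      ⟨interior (coneFiber 𝒩 x), isOpen_interior, singleton_subset_iff.2 hv, subset_rfl⟩)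
  obtain ⟨r, hr, hball⟩ := Metric.isOpen_iff.1 isOpen_interior v (singleton_subset_iff.1 hvu)
  have hpersist : ∀ w ∈ interior (coneFiber 𝒩 x),
      ∀ᶠ y in 𝓝 x, y ∈ X ∧ w ∈ coneFiber 𝒩 y := by
    intro w hw
    obtain ⟨V, hVo, hxV, hVX, hV⟩ := h𝒩.lsc x hx w hw
    filter_upwards [hVo.mem_nhds hxV] with y hy using ⟨hVX hy, interior_subset (hV y hy)⟩
  have hvert : ∀ᶠ y in 𝓝 x, ∀ w ∈ u, w ∈ coneFiber 𝒩 y :=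
    (Finset.eventually_all u).2 fun w hw ↦
      (hpersist w (hu (subset_convexHull ℝ _ hw))).mono fun _ h ↦ h.2
  refine ⟨v, r, hr, ?_⟩
  filter_upwards [hpersist v hv, hvert] with y hy hyu
  exact ⟨hy.1, hball.trans (interior_subset.trans
    (convexHull_min (fun w hw ↦ hyu w hw) (h𝒩.cone y hy.1).2.1))⟩

/-- Invariance along a straight segment whose direction lies in the cones. -/
theorem NInvariant.mem_of_segment_s4 {n : ℕ} {X : Set (Euc n)} {𝒩 : Set (Euc n × Euc n)}
    {P : Set (Euc n)} (hP : NInvariant X 𝒩 P) {p z : Euc n} (hp : p ∈ P)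
    (hX : segment ℝ p z ⊆ X) (hcone : ∀ y ∈ segment ℝ p z, z - p ∈ coneFiber 𝒩 y) :
    z ∈ P := by
  rcases eq_or_ne z p with rfl | hne
  · exact hp
  have hseg : ∀ t ∈ Icc (0 : ℝ) 1, p + t • (z - p) ∈ segment ℝ p z := fun t ht ↦ by
    rw [segment_eq_image']
    exact ⟨t, ht, rfl⟩
  have hderiv (t : ℝ) : HasDerivAt (fun t : ℝ ↦ p + t • (z - p)) (z - p) t := by
    simpa using ((hasDerivAt_id t).smul_const (z - p)).const_add p
  have h := hP (fun t ↦ p + t • (z - p)) (fun _ ↦ z - p)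
    ⟨fun t ht ↦ hX (hseg t ht), fun t _ ↦ (hderiv t).hasDerivWithinAt, continuousOn_const⟩
    (by simpa using hp) (fun t ht ↦ ⟨hcone _ (hseg t ht), sub_ne_zero.2 hne⟩)
    1 (right_mem_Icc.2 zero_le_one)
  simpa using h

/-- for `𝒩`-invariant `P, Q`, the closure of `P ∩ Q` in `X` equals the
intersection of the closures in `X`. -/
theorem stmt_4 {n : ℕ} (X : Set (Euc n)) (hX : IsOpen X)
    (𝒩 : Set (Euc n × Euc n)) (h𝒩 : IsConeFam X 𝒩)
    (P Q : Set (Euc n)) (hP : P ⊆ X) (hQ : Q ⊆ X)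
    (hPinv : NInvariant X 𝒩 P) (hQinv : NInvariant X 𝒩 Q) :
    closure (P ∩ Q) ∩ X = (closure P ∩ X) ∩ (closure Q ∩ X) := by
  refine Subset.antisymm (fun x hx ↦ ?_) ?_
  · exact ⟨⟨closure_mono inter_subset_left hx.1, hx.2⟩,
      closure_mono inter_subset_right hx.1, hx.2⟩
  rintro x ⟨⟨hxP, hxX⟩, hxQ, -⟩
  refine ⟨Metric.mem_closure_iff.2 fun ε hε ↦ ?_, hxX⟩
  obtain ⟨v, r, hr, hev⟩ := h𝒩.exists_ball_subset_coneFiber hxX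
  obtain ⟨δ, hδ, hball⟩ := Metric.eventually_nhds_iff_ball.1 hev
  obtain ⟨s, hs, hsv⟩ : ∃ s : ℝ, 0 < s ∧ s * ‖v‖ < min ε δ := by
    have hm : 0 < min ε δ := lt_min hε hδ
    refine ⟨min ε δ / (‖v‖ + 1), by positivity, ?_⟩
    rw [div_mul_eq_mul_div, div_lt_iff₀ (by positivity)]
    nlinarith
  have hdist : dist (x + s • v) x < min ε δ := by
    simpa [dist_eq_norm, norm_smul, abs_of_pos hs] using hsv
  have hreach : ∀ S : Set (Euc n), NInvariant X 𝒩 S → x ∈ closure S → x + s • v ∈ S := by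
    intro S hS hxS
    obtain ⟨p, hp, hxp⟩ := Metric.mem_closure_iff.1 hxS (min (s * r) δ)
      (lt_min (by positivity) hδ)
    have hseg : segment ℝ p (x + s • v) ⊆ Metric.ball x δ :=
      (convex_ball x δ).segment_subset
        (by rw [Metric.mem_ball, dist_comm]; exact hxp.trans_le (min_le_right _ _))
        (hdist.trans_le (min_le_right _ _))
    refine hS.mem_of_segment_s4 hp (fun y hy ↦ (hball y (hseg hy)).1) fun y hy ↦ ?_
    have hdir : x + s • v - p = s • (v + s⁻¹ • (x - p)) := by
      rw [smul_add, smul_inv_smul₀ hs.ne']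
      abel
    rw [hdir]
    refine (h𝒩.cone y (hball y (hseg hy)).1).2.2.1 s hs.le _ ((hball y (hseg hy)).2 ?_)
    have hlt : ‖x - p‖ < s * r := by
      simpa [dist_eq_norm] using hxp.trans_le (min_le_left _ _)
    rw [Metric.mem_ball, dist_eq_norm, add_sub_cancel_left, norm_smul, norm_inv,
      Real.norm_of_nonneg hs.le, inv_mul_lt_iff₀ hs]
    exact hlt
  refine ⟨x + s • v, ⟨hreach P hPinv hxP, hreach Q hQinv hxQ⟩, ?_⟩
  rw [dist_comm]
  exact hdist.trans_le (min_le_left _ _)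
end
end

section
/- Let X ⊆ ℝⁿ be an open set and let 𝒩 be a continuous round cone family on X. Then 𝒩-smooth functions exist locally: for every x ∈ X there exist an open neighborhood V ⊆ X of x and a linear functional ℓ : ℝⁿ → ℝ such that ℓ(τ) < 0 for every y ∈ V and every τ ∈ 𝒩_y ∖ {0}; in particular, the restriction of ℓ to V is an 𝒩-smooth function on V. -/
open Set

noncomputable section

theorem IsRoundCone.zero_mem {n : ℕ} {N : Set (Euc n)} (hN : IsRoundCone N) : (0 : Euc n) ∈ N :=
  (hN.2.2.2.2.ge rfl : (0 : Euc n) ∈ N ∩ -N).1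

/-- A round cone as a proper cone in the sense of Mathlib. -/
def IsRoundCone.toProperCone {n : ℕ} {N : Set (Euc n)} (hN : IsRoundCone N) :
    ProperCone ℝ (Euc n) where
  carrier := N
  add_mem' {a b} ha hb := by
    have h := hN.2.2.1 2 zero_le_two _
      (hN.2.1 ha hb one_half_pos.le one_half_pos.le (add_halves 1))
    rw [smul_add, smul_smul, smul_smul] at h
    norm_num at h
    exact h
  zero_mem' := hN.zero_mem
  smul_mem' c v hv := hN.2.2.1 c c.2 v hv
  isClosed' := hN.1

theorem IsRoundCone.exists_nonpos_neg {n : ℕ} {N : Set (Euc n)} (hN : IsRoundCone N) {v : Euc n}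
    (hv : v ∈ N) (hv0 : v ≠ 0) :
    ∃ f : Euc n →L[ℝ] ℝ, (∀ w ∈ N, f w ≤ 0) ∧ f v < 0 := by
  have hneg : -v ∉ hN.toProperCone := fun h =>
    hv0 (hN.2.2.2.2.le (⟨hv, h⟩ : v ∈ N ∩ -N))
  obtain ⟨f, hf, hfv⟩ := hN.toProperCone.hyperplane_separation_point hneg
  refine ⟨-f, fun w hw => ?_, ?_⟩
  · simpa using hf w hw
  · simpa using hfv

/-- A linear functional that is negative on the unit vectors of a cone is negative on all its
nonzero vectors. -/
theorem IsRoundCone.neg_of_neg_on_sphere {n : ℕ} {N : Set (Euc n)} (hN : IsRoundCone N)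
    {f : Euc n →L[ℝ] ℝ} (hf : ∀ v ∈ N ∩ Metric.sphere 0 1, f v < 0) {v : Euc n}
    (hv : v ∈ N \ {0}) : f v < 0 := by
  have hpos : 0 < ‖v‖ := norm_pos_iff.2 hv.2
  have h := hf (‖v‖⁻¹ • v) ⟨hN.2.2.1 _ (inv_nonneg.2 hpos.le) v hv.1, by
    simp [norm_smul, hpos.ne']⟩
  rw [map_smul, smul_eq_mul] at h
  exact (pos_iff_neg_of_mul_neg h).1 (inv_pos.2 hpos)

theorem IsRoundCone.exists_neg_on_sphere {n : ℕ} {N : Set (Euc n)} (hN : IsRoundCone N) :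
    ∃ f : Euc n →L[ℝ] ℝ, ∀ v ∈ N ∩ Metric.sphere 0 1, f v < 0 := by
  have hcomp : IsCompact (N ∩ Metric.sphere 0 1) := (isCompact_sphere _ _).inter_left hN.1
  suffices h : ∃ f : Euc n →L[ℝ] ℝ, (∀ w ∈ N, f w ≤ 0) ∧
      ∀ v ∈ N ∩ Metric.sphere 0 1, v ∈ N → f v < 0 by
    obtain ⟨f, -, hf⟩ := h
    exact ⟨f, fun v hv => hf v hv hv.1⟩
  refine hcomp.induction_on
    (p := fun s => ∃ f : Euc n →L[ℝ] ℝ, (∀ w ∈ N, f w ≤ 0) ∧ ∀ v ∈ s, v ∈ N → f v < 0)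
    ⟨0, by simp, by simp⟩ ?_ ?_ ?_
  · rintro s t hst ⟨f, hf, hft⟩
    exact ⟨f, hf, fun v hv => hft v (hst hv)⟩
  · rintro s t ⟨f, hf, hfs⟩ ⟨g, hg, hgt⟩
    refine ⟨f + g, fun w hw => add_nonpos (hf w hw) (hg w hw), ?_⟩
    rintro v (hv | hv) hvN
    · exact add_neg_of_neg_of_nonpos (hfs v hv hvN) (hg v hvN)
    · exact add_neg_of_nonpos_of_neg (hf v hvN) (hgt v hv hvN)
  · intro v hv
    have hv0 : v ≠ 0 := fun h => by simpa [h] using hv.2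
    obtain ⟨f, hf, hfv⟩ := hN.exists_nonpos_neg hv.1 hv0
    exact ⟨{w | f w < 0},
      mem_nhdsWithin_of_mem_nhds ((isOpen_lt f.continuous continuous_const).mem_nhds hfv),
      f, hf, fun w hw _ => hw⟩

/-- `𝒩`-smooth functions exist locally, given by linear functionals. -/
theorem stmt_6 {n : ℕ} (X : Set (Euc n)) (hX : IsOpen X)
    (𝒩 : Set (Euc n × Euc n)) (h𝒩 : IsConeFam X 𝒩)
    (x : Euc n) (hx : x ∈ X) :
    ∃ (V : Set (Euc n)) (ℓ : Euc n →L[ℝ] ℝ), IsOpen V ∧ x ∈ V ∧ V ⊆ X ∧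
      (∀ y ∈ V, ∀ τ ∈ coneFiber 𝒩 y \ {0}, ℓ τ < 0) ∧
      NSmoothOn 𝒩 (fun y => ℓ y) V := by
  obtain ⟨C, hC, h𝒩C⟩ := h𝒩.closed
  obtain ⟨ℓ, hℓ⟩ := (h𝒩.cone x hx).exists_neg_on_sphere
  have hmem : ∀ {y v}, y ∈ X → ((y, v) ∈ C ↔ v ∈ coneFiber 𝒩 y) := fun {y v} hy => by
    simp [coneFiber, h𝒩C, hy]
  have hK : IsCompact (Metric.sphere (0 : Euc n) 1 ∩ {v | 0 ≤ ℓ v}) :=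
    (isCompact_sphere _ _).inter_right (isClosed_le continuous_const ℓ.continuous)
  have hsub : {x} ×ˢ (Metric.sphere (0 : Euc n) 1 ∩ {v | 0 ≤ ℓ v}) ⊆ Cᶜ := by
    rintro ⟨y, v⟩ ⟨rfl, hv, hv0⟩ hvC
    exact (hℓ v ⟨(hmem hx).1 hvC, hv⟩).not_ge hv0
  obtain ⟨U, W, hU, -, hxU, hKW, hUW⟩ :=
    generalized_tube_lemma isCompact_singleton hK hC.isOpen_compl hsub
  have hneg : ∀ y ∈ U ∩ X, ∀ τ ∈ coneFiber 𝒩 y \ {0}, ℓ τ < 0 := by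
    rintro y ⟨hyU, hyX⟩ τ hτ
    refine (h𝒩.cone y hyX).neg_of_neg_on_sphere (fun v hv => ?_) hτ
    by_contra! hv0
    exact hUW (mk_mem_prod hyU (hKW ⟨hv.2, hv0⟩)) ((hmem hyX).2 hv.1)
  exact ⟨U ∩ X, ℓ, hU.inter hX, ⟨hxU rfl, hx⟩, inter_subset_right, hneg,
    fun _ => ℓ, continuousOn_const, fun _ _ => ℓ.hasFDerivAt, hneg⟩
end
end

section
/- Let X ⊆ ℝⁿ be an open set, let 𝒩 be a continuous round cone family on X, and let U ⊆ X be open and 𝒩-small. Let 𝒩′, 𝒩″ be continuous round cone families on U with 𝒩_U ⊆ 𝒩′ and 𝒩′ ⋐ 𝒩″, let W ⊆ U be 𝒩″-open, and let x ∈ U ∩ ((closure of W in X) ∖ W). Then the sets Q ∖ W, where Q ranges over the 𝒩′-open subsets of U containing x, form a base of neighborhoods of x in the subspace U ∖ W. -/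
open Set

noncomputable section

/-- A compact subset of an open set lies in the interior of the convex hull of finitely
many points of that set. -/
theorem exists_finite_subset_interior_convexHull {n : ℕ} {C O : Set (Euc n)}
    (hC : IsCompact C) (hO : IsOpen O) (hCO : C ⊆ O) :
    ∃ F : Set (Euc n), F.Finite ∧ F ⊆ O ∧ C ⊆ interior (convexHull ℝ F) := by
  have h : ∀ p ∈ C, ∃ F : Set (Euc n), F.Finite ∧ F ⊆ O ∧ p ∈ interior (convexHull ℝ F) := by
    intro p hp
    obtain ⟨b, hb, hbO⟩ := exists_mem_interior_convexHull_affineBasis (hO.mem_nhds (hCO hp))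
    exact ⟨range b, finite_range b, (subset_convexHull ℝ _).trans hbO, hb⟩
  choose! F hF hFO hpF using h
  obtain ⟨t, htC, ht⟩ := hC.elim_nhds_subcover (fun p => interior (convexHull ℝ (F p)))
    (fun p hp => isOpen_interior.mem_nhds (hpF p hp))
  refine ⟨⋃ p ∈ t, F p, t.finite_toSet.biUnion fun p hp => hF p (htC p hp),
    iUnion₂_subset fun p hp => hFO p (htC p hp), ht.trans (iUnion₂_subset fun p hp => ?_)⟩
  exact interior_mono (convexHull_mono (subset_biUnion_of_mem (s := (t : Set (Euc n))) (u := F) hp))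

/-- A compact subset of the interior of the fiber at `x` is contained in all nearby fibers. -/
theorem IsConeFam.eventually_subset_coneFiber {n : ℕ} {U : Set (Euc n)}
    {𝒩 : Set (Euc n × Euc n)} (h𝒩 : IsConeFam U 𝒩) (hU : IsOpen U) {x : Euc n} (hx : x ∈ U)
    {D : Set (Euc n)} (hD : IsCompact D) (hDx : D ⊆ interior (coneFiber 𝒩 x)) :
    ∀ᶠ y in nhds x, D ⊆ coneFiber 𝒩 y := by
  obtain ⟨F, hF, hFx, hDF⟩ := exists_finite_subset_interior_convexHull hD isOpen_interior hDx
  have hev : ∀ᶠ y in nhds x, ∀ v ∈ F, v ∈ coneFiber 𝒩 y := by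
    refine (Filter.eventually_all_finite hF).2 fun v hv => ?_
    obtain ⟨V, hV, hxV, -, h⟩ := h𝒩.lsc x hx v (hFx hv)
    filter_upwards [hV.mem_nhds hxV] with y hy using interior_subset (h y hy)
  filter_upwards [hev, hU.mem_nhds hx] with y hy hyU
  exact hDF.trans (interior_subset.trans (convexHull_min hy (h𝒩.cone y hyU).2.1))

/-- An open cone containing the nonzero vectors of the fiber at `x` contains the nonzero vectors of
all nearby fibers. -/
theorem IsConeFam.eventually_coneFiber_subset {n : ℕ} {U : Set (Euc n)}
    {𝒩 : Set (Euc n × Euc n)} (h𝒩 : IsConeFam U 𝒩) (hU : IsOpen U) {x : Euc n} (hx : x ∈ U)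
    {K : ConvexCone ℝ (Euc n)} (hK : IsOpen (K : Set (Euc n)))
    (hxK : coneFiber 𝒩 x \ {0} ⊆ K) :
    ∀ᶠ y in nhds x, coneFiber 𝒩 y \ {0} ⊆ K := by
  obtain ⟨C, hC, hNC⟩ := h𝒩.closed
  have hS : IsCompact (Metric.sphere (0 : Euc n) 1 \ K) := (isCompact_sphere 0 1).diff hK
  obtain ⟨u, v, hu, -, hxu, hv, huv⟩ := generalized_tube_lemma (isCompact_singleton (x := x)) hS
    hC.isOpen_compl (by
      rintro ⟨y, w⟩ ⟨hy, hw, hwK⟩ hwC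
      obtain rfl : y = x := hy
      refine hwK (hxK ⟨?_, ?_⟩)
      · change (y, w) ∈ 𝒩
        rw [hNC]
        exact ⟨hwC, hx, mem_univ _⟩
      · rintro rfl
        simp at hw)
  filter_upwards [hu.mem_nhds (hxu rfl), hU.mem_nhds hx] with y hy hyU w ⟨hw, hw0⟩
  have hw0' : 0 < ‖w‖ := norm_pos_iff.2 hw0
  have hunit : ‖w‖⁻¹ • w ∈ K := by
    by_contra hcon
    have hmem : ‖w‖⁻¹ • w ∈ coneFiber 𝒩 y :=
      (h𝒩.cone y hyU).2.2.1 _ (inv_nonneg.2 hw0'.le) w hw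
    have hmem' : (y, ‖w‖⁻¹ • w) ∈ 𝒩 := hmem
    rw [hNC] at hmem'
    refine huv (⟨hy, hv ⟨?_, hcon⟩⟩ : (y, ‖w‖⁻¹ • w) ∈ u ×ˢ v) hmem'.1
    simp [norm_smul, hw0'.ne']
  have := K.smul_mem hw0' hunit
  rwa [smul_inv_smul₀ hw0'.ne'] at this

/-- An arc whose velocity stays in an open convex cone `K` does not leave a translate of `K`. -/
theorem sub_mem_of_hasDerivWithinAt_mem_cone {n : ℕ} {K : ConvexCone ℝ (Euc n)}
    (hK : IsOpen (K : Set (Euc n))) {γ γ' : ℝ → Euc n} {s : ℝ} (hs : 0 ≤ s) {c : Euc n}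
    (hγ : ∀ t ∈ Icc 0 s, HasDerivWithinAt γ (γ' t) (Icc 0 s) t)
    (hγ' : ∀ t ∈ Ioo 0 s, γ' t ∈ K) (h0 : γ 0 - c ∈ K) : γ s - c ∈ K := by
  by_contra hcon
  obtain ⟨f, hf⟩ := geometric_hahn_banach_open_point K.convex hK hcon
  have hfK : ∀ k ∈ K, f k ≤ 0 := by
    intro k hk
    by_contra! hpos
    have h := hf _ (K.smul_mem (c := (|f (γ s - c)| + 1) / f k) (by positivity) hk)
    rw [map_smul, smul_eq_mul, div_mul_cancel₀ _ hpos.ne'] at h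
    linarith [le_abs_self (f (γ s - c))]
  have hanti : AntitoneOn (fun t => f (γ t)) (Icc 0 s) := by
    refine antitoneOn_of_hasDerivWithinAt_nonpos (f' := fun t => f (γ' t)) (convex_Icc 0 s)
      (fun t ht => (f.continuous.continuousAt.comp_continuousWithinAt
        (hγ t ht).continuousWithinAt)) ?_ ?_
    · intro t ht
      exact f.hasFDerivAt.comp_hasDerivWithinAt t ((hγ t (interior_subset ht)).mono interior_subset)
    · intro t ht
      rw [interior_Icc] at ht
      exact hfK _ (hγ' t ht)
  have h1 : f (γ s) ≤ f (γ 0) := hanti ⟨le_rfl, hs⟩ ⟨hs, le_rfl⟩ hs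
  have h2 := hf _ h0
  rw [map_sub, map_sub] at h2
  linarith

/-- An invariant set is stable along any subinterval of an admissible arc. -/
theorem NInvariant.mem_of_le {n : ℕ} {U : Set (Euc n)} {𝒩 : Set (Euc n × Euc n)}
    (hcone : ∀ y ∈ U, IsRoundCone (coneFiber 𝒩 y)) {W : Set (Euc n)} (hW : NInvariant U 𝒩 W)
    {γ γ' : ℝ → Euc n} (hγ : IsC1ArcIn U γ γ')
    (hγ' : ∀ t ∈ Icc (0 : ℝ) 1, γ' t ∈ coneFiber 𝒩 (γ t) \ {0})
    {s t : ℝ} (hs : 0 ≤ s) (hst : s ≤ t) (ht : t ≤ 1) (hsW : γ s ∈ W) : γ t ∈ W := by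
  rcases hst.eq_or_lt with rfl | hlt
  · exact hsW
  have hpos : 0 < t - s := sub_pos.2 hlt
  have hmaps : MapsTo (fun u : ℝ => s + u * (t - s)) (Icc 0 1) (Icc 0 1) := by
    rintro u ⟨hu0, hu1⟩
    constructor <;> nlinarith
  have hderiv : ∀ u : ℝ, HasDerivWithinAt (fun u : ℝ => s + u * (t - s)) (t - s) (Icc 0 1) u := by
    intro u
    simpa using (((hasDerivAt_id u).mul_const (t - s)).const_add s).hasDerivWithinAt
  have harc : IsC1ArcIn U (fun u => γ (s + u * (t - s)))
      (fun u => (t - s) • γ' (s + u * (t - s))) :=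
    { maps := fun u hu => hγ.maps _ (hmaps hu)
      deriv := fun u hu => (hγ.deriv _ (hmaps hu)).scomp u (hderiv u) hmaps
      cont := (hγ.cont.comp (by fun_prop) hmaps).const_smul (t - s) }
  have := hW _ _ harc (by simpa using hsW) (fun u hu => by
    obtain ⟨h1, h2⟩ := hγ' _ (hmaps hu)
    exact ⟨(hcone _ (hγ.maps _ (hmaps hu))).2.2.1 _ hpos.le _ h1,
      smul_ne_zero hpos.ne' h2⟩) 1 ⟨zero_le_one, le_rfl⟩
  simpa using this

/-- An invariant set contains the endpoint of any admissible segment starting in it. -/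
theorem NInvariant.mem_of_segment_s8 {n : ℕ} {U : Set (Euc n)} {𝒩 : Set (Euc n × Euc n)}
    {W : Set (Euc n)} (hW : NInvariant U 𝒩 W) {w y : Euc n} (hw : w ∈ W) (hne : y ≠ w)
    (hU : segment ℝ w y ⊆ U) (h : ∀ z ∈ segment ℝ w y, y - w ∈ coneFiber 𝒩 z) : y ∈ W := by
  have hseg : ∀ t ∈ Icc (0 : ℝ) 1, w + t • (y - w) ∈ segment ℝ w y := by
    intro t ht
    rw [segment_eq_image']
    exact mem_image_of_mem _ ht
  have := hW (fun t => w + t • (y - w)) (fun _ => y - w)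
    { maps := fun t ht => hU (hseg t ht)
      deriv := fun t _ => by
        simpa using (((hasDerivAt_id t).smul_const (y - w)).const_add w).hasDerivWithinAt
      cont := continuousOn_const } (by simpa using hw)
    (fun t ht => ⟨h _ (hseg t ht), sub_ne_zero.2 hne⟩) 1 ⟨zero_le_one, le_rfl⟩
  simpa using this

open scoped Pointwise in
/-- The cone generated by an open convex set is open. -/
theorem isOpen_coneHull {n : ℕ} {B : Set (Euc n)} (hB : Convex ℝ B) (hBo : IsOpen B) :
    IsOpen (ConvexCone.hull ℝ B : Set (Euc n)) := by
  have : (ConvexCone.hull ℝ B : Set (Euc n)) = ⋃ c : ℝ, ⋃ _ : 0 < c, c • B := by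
    ext v
    simp [ConvexCone.mem_hull_of_convex hB]
  rw [this]
  exact isOpen_iUnion fun c => isOpen_iUnion fun hc => hBo.smul₀ hc.ne'

/-- There is an open cone `K` squeezed between the two fibers at `x`, such that small
perturbations of vectors of `K` that are not short lie in all nearby fibers of `𝒩''`. -/
theorem exists_open_cone_between {n : ℕ} {U : Set (Euc n)} (hU : IsOpen U)
    {𝒩' 𝒩'' : Set (Euc n × Euc n)} (h𝒩' : IsConeFam U 𝒩') (h𝒩'' : IsConeFam U 𝒩'')
    {x : Euc n} (hx : x ∈ U) (hcomp : coneFiber 𝒩' x \ {0} ⊆ interior (coneFiber 𝒩'' x)) :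
    ∃ K : ConvexCone ℝ (Euc n), IsOpen (K : Set (Euc n)) ∧ coneFiber 𝒩' x \ {0} ⊆ K ∧
      ∃ κ > 0, ∀ᶠ z in nhds x, ∀ k ∈ K, ∀ q : Euc n, ‖q‖ ≤ κ * ‖k‖ → k + q ∈ coneFiber 𝒩'' z := by
  have hcone' := h𝒩'.cone x hx
  have hcone'' := h𝒩''.cone x hx
  have hS : IsCompact (coneFiber 𝒩' x ∩ Metric.sphere 0 1) :=
    (isCompact_sphere 0 1).inter_left hcone'.1
  obtain ⟨F, hF, hFx, hSF⟩ := exists_finite_subset_interior_convexHull hS isOpen_interior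
    (fun v hv => hcomp ⟨hv.1, by rintro rfl; simpa using hv.2⟩)
  have hHc : IsCompact (convexHull ℝ F) := hF.isCompact_convexHull ℝ
  have hHx : convexHull ℝ F ⊆ interior (coneFiber 𝒩'' x) :=
    convexHull_min hFx hcone''.2.1.interior
  obtain ⟨δ, hδ, hδx⟩ := hHc.exists_cthickening_subset_open isOpen_interior hHx
  obtain ⟨M, hM⟩ := hHc.isBounded.exists_norm_le
  have hBconv : Convex ℝ (interior (convexHull ℝ F)) := (convex_convexHull ℝ F).interior
  refine ⟨ConvexCone.hull ℝ _, isOpen_coneHull hBconv isOpen_interior, ?_, δ / (|M| + 1), by positivity,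
    ?_⟩
  · rintro v ⟨hv, hv0⟩
    have hv0' : 0 < ‖v‖ := norm_pos_iff.2 hv0
    refine (ConvexCone.mem_hull_of_convex hBconv).2
      ⟨‖v‖, hv0', (mem_smul_set_iff_inv_smul_mem₀ hv0'.ne' _ _).2 (hSF ⟨?_, ?_⟩)⟩
    · exact hcone'.2.2.1 _ (inv_nonneg.2 hv0'.le) v hv
    · simp [norm_smul, hv0'.ne']
  · filter_upwards [h𝒩''.eventually_subset_coneFiber hU hx hHc.cthickening hδx,
      hU.mem_nhds hx] with z hz hzU k hk q hq
    obtain ⟨c, hc, b, hb, rfl⟩ := (ConvexCone.mem_hull_of_convex hBconv).1 hk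
    have hb' := interior_subset hb
    have hmem : b + c⁻¹ • q ∈ Metric.cthickening δ (convexHull ℝ F) := by
      refine Metric.mem_cthickening_of_dist_le _ b _ _ hb' ?_
      have h1 : ‖b‖ ≤ |M| + 1 := (hM b hb').trans (by linarith [le_abs_self M])
      have h2 : δ / (|M| + 1) * ‖b‖ ≤ δ := by
        rw [div_mul_eq_mul_div, div_le_iff₀ (by positivity)]
        gcongr
      rw [dist_eq_norm, add_sub_cancel_left, norm_smul, norm_inv, Real.norm_of_nonneg hc.le,
        inv_mul_le_iff₀ hc]
      rw [norm_smul, Real.norm_of_nonneg hc.le] at hq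
      nlinarith
    have := (h𝒩''.cone z hzU).2.2.1 c hc.le _ (hz hmem)
    rwa [smul_add, smul_inv_smul₀ hc.ne'] at this

/-- A path starting in an open ball and leaving it has a first point on the bounding sphere. -/
theorem exists_first_dist_eq {E : Type*} [PseudoMetricSpace E] {γ : ℝ → E} {t ε : ℝ} {x : E}
    (hγ : ContinuousOn γ (Icc 0 t)) (h0 : dist (γ 0) x < ε) {s : ℝ} (hs : s ∈ Icc 0 t)
    (hsε : ε ≤ dist (γ s) x) :
    ∃ r ∈ Icc 0 t, dist (γ r) x = ε ∧ ∀ u, 0 ≤ u → u < r → dist (γ u) x < ε := by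
  have hd : ContinuousOn (fun u => dist (γ u) x) (Icc 0 t) := (continuous_id.dist continuous_const).comp_continuousOn hγ
  have hivt : ∀ u ∈ Icc 0 t, ε ≤ dist (γ u) x → ∃ v ∈ Icc 0 u, dist (γ v) x = ε := by
    intro u hu huε
    exact intermediate_value_Icc hu.1 (hd.mono (Icc_subset_Icc_right hu.2)) ⟨h0.le, huε⟩
  have hclosed : IsCompact (Icc 0 t ∩ (fun u => dist (γ u) x) ⁻¹' {ε}) :=
    isCompact_Icc.of_isClosed_subset (hd.preimage_isClosed_of_isClosed isClosed_Icc
      isClosed_singleton) inter_subset_left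
  obtain ⟨v, hv, hvε⟩ := hivt s hs hsε
  obtain ⟨r, ⟨hr, hrε⟩, hmin⟩ := hclosed.exists_isLeast ⟨v, ⟨hv.1, hv.2.trans hs.2⟩, hvε⟩
  refine ⟨r, hr, hrε, fun u hu0 hur => ?_⟩
  by_contra! hcon
  obtain ⟨w, hw, hwε⟩ := hivt u ⟨hu0, hur.le.trans hr.2⟩ hcon
  have := hmin ⟨⟨hw.1, hw.2.trans (hur.le.trans hr.2)⟩, hwε⟩
  linarith [hw.2]

/-- with `𝒩_U ⊆ 𝒩' ⋐ 𝒩''` and `W` an `𝒩''`-open subset of `U`, for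
`x ∈ U ∩ (∂W)` the sets `Q \ W`, `Q` an `𝒩'`-open set containing `x`, form a base of
neighborhoods of `x` in `U \ W`. -/
theorem stmt_8 {n : ℕ} (X : Set (Euc n)) (hX : IsOpen X)
    (𝒩 : Set (Euc n × Euc n)) (h𝒩 : IsConeFam X 𝒩)
    (U : Set (Euc n)) (hUo : IsOpen U) (hUX : U ⊆ X) (hUsmall : NSmall X 𝒩 U)
    (𝒩' 𝒩'' : Set (Euc n × Euc n)) (h𝒩' : IsConeFam U 𝒩') (h𝒩'' : IsConeFam U 𝒩'')
    (hsub : coneRestrict 𝒩 U ⊆ 𝒩')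
    (hcomp : ∀ y ∈ U, coneFiber 𝒩' y \ {0} ⊆ interior (coneFiber 𝒩'' y))
    (W : Set (Euc n)) (hW : NOpen U 𝒩'' W)
    (x : Euc n) (hx : x ∈ U ∩ ((closure W ∩ X) \ W)) :
    (∀ Q : Set (Euc n), NOpen U 𝒩' Q → x ∈ Q → Q \ W ∈ nhdsWithin x (U \ W)) ∧
    (∀ T ∈ nhdsWithin x (U \ W),
      ∃ Q : Set (Euc n), NOpen U 𝒩' Q ∧ x ∈ Q ∧ Q \ W ⊆ T) := by
  obtain ⟨hxU, ⟨hxWcl, -⟩, hxW⟩ := hx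
  obtain ⟨hWU, hWo, hWinv⟩ := hW
  constructor
  · rintro Q ⟨hQU, hQo, -⟩ hxQ
    filter_upwards [mem_nhdsWithin_of_mem_nhds (hQo.mem_nhds hxQ), self_mem_nhdsWithin]
      with y hyQ hy using ⟨hyQ, hy.2⟩
  intro T hT
  obtain ⟨K, hKo, hxK, κ, hκ, hperturb⟩ :=
    exists_open_cone_between hUo h𝒩' h𝒩'' hxU (hcomp x hxU)
  obtain ⟨G, hG, hGT⟩ := mem_nhdsWithin_iff_exists_mem_nhds_inter.1 hT
  obtain ⟨ε, hε, hball⟩ := Metric.nhds_basis_closedBall.eventually_iff.1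
    ((hperturb.and (h𝒩'.eventually_coneFiber_subset hUo hxU hKo hxK)).and
      (Filter.inter_mem (hUo.mem_nhds hxU) hG))
  obtain ⟨v, hv⟩ : (K : Set (Euc n)).Nonempty := by
    rcases subsingleton_or_nontrivial (Euc n) with hn | hn
    · obtain ⟨w, hw⟩ := closure_nonempty_iff.1 ⟨x, hxWcl⟩
      exact absurd (Subsingleton.elim w x ▸ hw) hxW
    · by_contra hK
      rw [not_nonempty_iff_eq_empty] at hK
      have h0 : coneFiber 𝒩' x ⊆ {0} := sdiff_eq_empty.1 (subset_empty_iff.1 (hK ▸ hxK))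
      obtain ⟨u, hu⟩ := (h𝒩'.cone x hxU).2.2.2.1
      have := interior_mono h0 hu
      rw [interior_singleton] at this
      exact this
  obtain ⟨η, hη, hηε, hηκ⟩ : ∃ η > 0, 2 * η ≤ ε ∧ 2 * η ≤ κ * (ε / 2) :=
    ⟨min (ε / 2) (κ * (ε / 2) / 2), by positivity, by
      linarith [min_le_left (ε / 2) (κ * (ε / 2) / 2)], by
      linarith [min_le_right (ε / 2) (κ * (ε / 2) / 2)]⟩
  obtain ⟨a, haK, haη⟩ : ∃ a ∈ K, ‖a‖ ≤ η := by
    refine ⟨(η / (‖v‖ + 1)) • v, K.smul_mem (by positivity) hv, ?_⟩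
    rw [norm_smul, Real.norm_of_nonneg (by positivity), div_mul_eq_mul_div,
      div_le_iff₀ (by positivity)]
    nlinarith [norm_nonneg v]
  obtain ⟨w, hwW, hwη⟩ := Metric.mem_closure_iff.1 hxWcl η hη
  have hwε : dist w x < ε := by rw [dist_comm]; linarith
  have hsphere : ∀ y, dist y x = ε → y - (x - a) ∈ K → y ∈ W := by
    intro y hy hyK
    have hseg : segment ℝ w y ⊆ Metric.closedBall x ε :=
      (convex_closedBall x ε).segment_subset hwε.le hy.le
    refine hWinv.mem_of_segment_s8 hwW (by rintro rfl; exact hwε.ne hy)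
      (fun z hz => (hball (hseg hz)).2.1) fun z hz => ?_
    have hdecomp : y - w = (y - (x - a)) + (x - w - a) := by abel
    rw [hdecomp]
    refine (hball (hseg hz)).1.1 _ hyK _ ?_
    have h1 : ‖x - w - a‖ ≤ 2 * η := by
      have := norm_sub_le (x - w) a
      rw [dist_eq_norm] at hwη
      linarith
    have h2 : ε / 2 ≤ ‖y - (x - a)‖ := by
      have h3 : y - x = (y - (x - a)) - a := by abel
      have := norm_sub_le (y - (x - a)) a
      rw [← h3, ← dist_eq_norm, hy] at this
      linarith
    nlinarith
  refine ⟨W ∪ {y | dist y x < ε ∧ y - (x - a) ∈ K}, ⟨?_, ?_, ?_⟩, Or.inr ⟨by simpa, by simpa⟩, ?_⟩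
  · rintro y (hy | hy)
    · exact hWU hy
    · exact (hball (Metric.mem_closedBall.2 hy.1.le)).2.1
  · exact hWo.union ((Metric.isOpen_ball (x := x) (ε := ε)).inter
      (hKo.preimage (by fun_prop : Continuous fun y : Euc n => y - (x - a))))
  · intro γ γ' hγ h0 hγ' t ht
    have hγ'' : ∀ u ∈ Icc (0 : ℝ) 1, γ' u ∈ coneFiber 𝒩'' (γ u) \ {0} := fun u hu =>
      ⟨interior_subset (hcomp _ (hγ.maps u hu) (hγ' u hu)), (hγ' u hu).2⟩
    rcases h0 with h0 | ⟨h0, h0K⟩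
    · exact Or.inl (hWinv _ _ hγ h0 hγ'' t ht)
    have hstay : ∀ r ∈ Icc (0 : ℝ) 1, (∀ u, 0 ≤ u → u < r → dist (γ u) x < ε) →
        γ r - (x - a) ∈ K := by
      intro r hr hlt
      have hsub : Icc 0 r ⊆ Icc (0 : ℝ) 1 := Icc_subset_Icc_right hr.2
      refine sub_mem_of_hasDerivWithinAt_mem_cone hKo hr.1
        (fun u hu => (hγ.deriv u (hsub hu)).mono hsub) (fun u hu => ?_) h0K
      exact (hball (Metric.mem_closedBall.2 (hlt u hu.1.le hu.2).le)).1.2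
        (hγ' u (hsub (Ioo_subset_Icc_self hu)))
    by_cases hin : ∀ s ∈ Icc 0 t, dist (γ s) x < ε
    · exact Or.inr ⟨hin t ⟨ht.1, le_rfl⟩,
        hstay t ht fun u hu0 hut => hin u ⟨hu0, hut.le⟩⟩
    · push Not at hin
      obtain ⟨s, hs, hsε⟩ := hin
      obtain ⟨r, hr, hrε, hlt⟩ := exists_first_dist_eq
        (fun u hu => ((hγ.deriv u ⟨hu.1, hu.2.trans ht.2⟩).continuousWithinAt.mono
          (Icc_subset_Icc_right ht.2))) h0 hs hsε
      have hrW : γ r ∈ W := hsphere _ hrε (hstay r ⟨hr.1, hr.2.trans ht.2⟩ hlt)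
      exact Or.inl (hWinv.mem_of_le h𝒩''.cone hγ hγ'' hr.1 hr.2 ht.2 hrW)
  · rintro y ⟨hy | hy, hyW⟩
    · exact absurd hy hyW
    · have := hball (Metric.mem_closedBall.2 hy.1.le)
      exact hGT ⟨this.2.2, this.2.1, hyW⟩
end
end

section
/- Let X ⊆ ℝⁿ be an open set, let 𝒩 be a continuous round cone family on X, let Z ⊆ X be 𝒩-special, and set U₀ := interior(Z). Then Z is recovered from U₀ as follows: every x ∈ (closure of Z in X) ∖ U₀ has an open neighborhood V ⊆ X such that for every C¹-arc γ : [0,1] → V with γ(0) = x and γ′(t) ∈ (−𝒩_{γ(t)}) ∖ {0} for all t ∈ [0,1]: if x ∈ Z then γ((0,1]) ⊆ U₀, and if x ∉ Z then γ((0,1]) is disjoint from the closure of U₀ in X. -/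
open Set

noncomputable section

/-- The pairs `(y, v)` with `v ≠ 0` in the interior of the fiber at `y` form an open set. -/
theorem IsConeFam.isOpen_interior_fiber {n : ℕ} {V : Set (Euc n)} {𝒩 : Set (Euc n × Euc n)}
    (h𝒩 : IsConeFam V 𝒩) :
    IsOpen {p : Euc n × Euc n | p.1 ∈ V ∧ p.2 ∈ interior (coneFiber 𝒩 p.1) ∧ p.2 ≠ 0} := by
  rw [isOpen_iff_mem_nhds]
  rintro ⟨x, v⟩ ⟨hx, hv, hv0⟩
  obtain ⟨b, hvb, hb⟩ :=
    exists_mem_interior_convexHull_affineBasis (isOpen_interior.mem_nhds hv)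
  have hbi (i) : b i ∈ interior (coneFiber 𝒩 x) :=
    hb (subset_convexHull ℝ _ (mem_range_self i))
  choose W hWo hxW hWV hW using fun i => h𝒩.lsc x hx (b i) (hbi i)
  have hnhds : (⋂ i, W i) ∈ nhds x :=
    Filter.iInter_mem.2 fun i => (hWo i).mem_nhds (hxW i)
  filter_upwards [prod_mem_nhds hnhds
    ((isOpen_interior.inter isOpen_ne).mem_nhds ⟨hvb, hv0⟩)] with p ⟨hp₁, hp₂, hp₀⟩
  have hp (i) : p.1 ∈ W i := mem_iInter.1 hp₁ i
  have hpV : p.1 ∈ V := hWV 0 (hp 0)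
  refine ⟨hpV, interior_mono ?_ hp₂, hp₀⟩
  refine convexHull_min ?_ (h𝒩.cone _ hpV).2.1
  rintro _ ⟨i, rfl⟩
  exact interior_subset (hW i _ (hp i))

open scoped Pointwise in
/-- An arc running backwards along the interior of the cones, starting outside an `𝒩`-open
set, immediately leaves its closure. -/
theorem NOpen.notMem_closure_of_backward_arc {n : ℕ} {V : Set (Euc n)}
    {𝒩 : Set (Euc n × Euc n)} (h𝒩 : IsConeFam V 𝒩) {U : Set (Euc n)} (hU : NOpen V 𝒩 U)
    {γ γ' : ℝ → Euc n} (hγ : IsC1ArcIn V γ γ') (h0 : γ 0 ∉ U)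
    (hint : ∀ t ∈ Icc (0 : ℝ) 1, -γ' t ∈ interior (coneFiber 𝒩 (γ t)))
    (hne : ∀ t ∈ Icc (0 : ℝ) 1, γ' t ≠ 0) {t : ℝ} (ht : t ∈ Ioc (0 : ℝ) 1) :
    γ t ∉ closure U := by
  intro hcl
  have hmaps : MapsTo (fun s : ℝ => t - t * s) (Icc 0 1) (Icc 0 1) := by
    intro s hs
    have h₁ : 0 ≤ t * (1 - s) := mul_nonneg ht.1.le (by linarith [hs.2])
    have h₂ : 0 ≤ t * s := mul_nonneg ht.1.le hs.1
    constructor <;> linarith [ht.2]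
  have hγc : ContinuousOn γ (Icc 0 1) := fun s hs => (hγ.deriv s hs).continuousWithinAt
  have hrep : ContinuousOn (fun s : ℝ => t - t * s) (Icc 0 1) := by fun_prop
  have hvel : ContinuousOn (fun s : ℝ => -(t • γ' (t - t * s))) (Icc 0 1) :=
    ((hγ.cont.comp hrep hmaps).const_smul t).neg
  have hK := isCompact_Icc.image_of_continuousOn ((hγc.comp hrep hmaps).prodMk hvel)
  obtain ⟨δ, hδ, hsub⟩ := hK.exists_thickening_subset_open h𝒩.isOpen_interior_fiber (by
    rintro _ ⟨s, hs, rfl⟩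
    have hs' := hmaps hs
    refine ⟨hγ.maps _ hs', ?_, neg_ne_zero.2 (smul_ne_zero ht.1.ne' (hne _ hs'))⟩
    have hsc : t • interior (coneFiber 𝒩 (γ (t - t * s))) ⊆
        interior (coneFiber 𝒩 (γ (t - t * s))) := by
      rw [← interior_smul₀ ht.1.ne']
      refine interior_mono ?_
      rintro _ ⟨v, hv, rfl⟩
      exact (h𝒩.cone _ (hγ.maps _ hs')).2.2.1 t ht.1.le v hv
    have := hsc (smul_mem_smul_set (hint _ hs'))
    rwa [smul_neg] at this)
  obtain ⟨y, hyU, hy⟩ := Metric.mem_closure_iff.1 hcl δ hδ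
  have hnorm : ‖y - γ t‖ < δ := by rwa [← dist_eq_norm, dist_comm]
  have hmem : ∀ s ∈ Icc (0 : ℝ) 1,
      (γ (t - t * s) + (1 - s) • (y - γ t), -(t • γ' (t - t * s)) - (y - γ t)) ∈
        {p : Euc n × Euc n | p.1 ∈ V ∧ p.2 ∈ interior (coneFiber 𝒩 p.1) ∧ p.2 ≠ 0} := by
    intro s hs
    refine hsub (Metric.mem_thickening_iff.2 ⟨_, mem_image_of_mem _ hs, ?_⟩)
    rw [Prod.dist_eq, max_lt_iff]
    constructor
    · rw [dist_eq_norm]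
      simp only [Function.comp_apply, add_sub_cancel_left, norm_smul, Real.norm_eq_abs]
      rw [abs_of_nonneg (by linarith [hs.2])]
      exact (mul_le_of_le_one_left (norm_nonneg _) (by linarith [hs.1])).trans_lt hnorm
    · rwa [dist_eq_norm, sub_sub_cancel_left, norm_neg]
  have hend := hU.2.2 (fun s => γ (t - t * s) + (1 - s) • (y - γ t))
    (fun s => -(t • γ' (t - t * s)) - (y - γ t))
    { maps := fun s hs => (hmem s hs).1
      deriv := fun s hs => by
        have h₁ : HasDerivWithinAt (fun s : ℝ => t - t * s) (-t) (Icc 0 1) s := by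
          simpa using (((hasDerivAt_id s).const_mul t).const_sub t).hasDerivWithinAt
        have h₂ : HasDerivWithinAt (fun s : ℝ => 1 - s) (-1) (Icc 0 1) s := by
          simpa using ((hasDerivAt_id s).const_sub 1).hasDerivWithinAt
        have h₃ := ((hγ.deriv _ (hmaps hs)).scomp s h₁ hmaps).add (h₂.smul_const (y - γ t))
        refine h₃.congr_deriv ?_
        rw [neg_smul, neg_smul, one_smul, ← sub_eq_add_neg]
      cont := hvel.sub continuousOn_const }
    (by simpa using hyU)
    (fun s hs => ⟨interior_subset (hmem s hs).2.1, (hmem s hs).2.2⟩)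
    1 (right_mem_Icc.2 zero_le_one)
  exact h0 (by simpa using hend)

/-- an `𝒩`-special `Z` is recovered from `U₀ = Int(Z)` via arcs with
velocity in `(-𝒩) \ {0}`. -/
theorem stmt_10 {n : ℕ} (X : Set (Euc n)) (hX : IsOpen X)
    (𝒩 : Set (Euc n × Euc n)) (h𝒩 : IsConeFam X 𝒩)
    (Z : Set (Euc n)) (hZ : NSpecial X 𝒩 Z) :
    ∀ x ∈ (closure Z ∩ X) \ interior Z,
      ∃ V : Set (Euc n), IsOpen V ∧ x ∈ V ∧ V ⊆ X ∧
        ∀ γ γ' : ℝ → Euc n, IsC1ArcIn V γ γ' → γ 0 = x →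
          (∀ t ∈ Icc (0:ℝ) 1, γ' t ∈ (-(coneFiber 𝒩 (γ t))) \ {0}) →
          ((x ∈ Z → ∀ t ∈ Ioc (0:ℝ) 1, γ t ∈ interior Z) ∧
           (x ∉ Z → ∀ t ∈ Ioc (0:ℝ) 1, γ t ∉ closure (interior Z) ∩ X)) := by
  rintro x ⟨⟨hxZ, hxX⟩, -⟩
  obtain ⟨V, 𝒩', hVo, hxV, hVX, h𝒩', hsub, U₁, U₂, hU₁, hU₂, hZV⟩ := hZ.2 x ⟨hxZ, hxX⟩
  have key : ∀ U : Set (Euc n), NOpen V 𝒩' U → x ∉ U → ∀ γ γ' : ℝ → Euc n,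
      IsC1ArcIn V γ γ' → γ 0 = x →
      (∀ t ∈ Icc (0:ℝ) 1, γ' t ∈ (-(coneFiber 𝒩 (γ t))) \ {0}) →
      ∀ t ∈ Ioc (0:ℝ) 1, γ t ∉ closure U := by
    rintro U hU hxU γ γ' hγ rfl hγ' t ht
    refine hU.notMem_closure_of_backward_arc h𝒩' hγ hxU (fun s hs => ?_)
      (fun s hs => (hγ' s hs).2) ht
    exact hsub _ (hγ.maps s hs)
      ⟨⟨(hγ' s hs).1, hγ.maps s hs, mem_univ _⟩, neg_ne_zero.2 (hγ' s hs).2⟩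
  by_cases hx : x ∈ Z
  · have hxU : x ∈ U₁ \ U₂ := hZV ▸ ⟨hx, hxV⟩
    refine ⟨U₁, hU₁.2.1, hxU.1, hU₁.1.trans hVX, fun γ γ' hγ h0 hγ' =>
      ⟨fun _ t ht => ?_, fun h => absurd hx h⟩⟩
    have hcl := key U₂ hU₂ hxU.2 γ γ'
      ⟨fun s hs => hU₁.1 (hγ.maps s hs), hγ.deriv, hγ.cont⟩ h0 hγ' t ht
    refine interior_maximal ?_ (hU₁.2.1.sdiff isClosed_closure)
      ⟨hγ.maps t (Ioc_subset_Icc_self ht), hcl⟩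
    intro z hz
    have hz' : z ∈ U₁ \ U₂ := ⟨hz.1, fun h => hz.2 (subset_closure h)⟩
    rw [← hZV] at hz'
    exact hz'.1
  · refine ⟨V, hVo, hxV, hVX, fun γ γ' hγ h0 hγ' => ⟨fun h => absurd h hx, fun _ t ht hcl => ?_⟩⟩
    have hxU₂ : x ∉ U₂ := by
      intro h
      obtain ⟨z, hzU, hzZ⟩ := mem_closure_iff.1 hxZ U₂ hU₂.2.1 h
      have hz : z ∈ U₁ \ U₂ := hZV ▸ ⟨hzZ, hU₂.1 hzU⟩
      exact hz.2 hzU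
    have hxU₁ : x ∉ U₁ := by
      intro h
      have hz : x ∈ Z ∩ V := hZV ▸ ⟨h, hxU₂⟩
      exact hx hz.1
    refine key U₁ hU₁ hxU₁ γ γ' hγ h0 hγ' t ht ?_
    refine mem_closure_iff.2 fun W hW hγW => ?_
    obtain ⟨z, ⟨hzW, hzV⟩, hzZ⟩ := mem_closure_iff.1 hcl.1 (W ∩ V) (hW.inter hVo)
      ⟨hγW, hγ.maps t (Ioc_subset_Icc_self ht)⟩
    have hz : z ∈ U₁ \ U₂ := hZV ▸ ⟨interior_subset hzZ, hzV⟩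
    exact ⟨z, hzW, hz.1⟩
end
end

section
/- Let X ⊆ ℝⁿ be an open set, let 𝒩 be a continuous round cone family on X, and let Z ⊆ X be 𝒩-special. If 𝒩̃ is a continuous round cone family on X with 𝒩̃_x = 𝒩_x for every x ∈ interior(Z), then Z is 𝒩̃-special; if moreover Z is an 𝒩-lens, then Z is an 𝒩̃-lens. -/
open Set

noncomputable section

open Topology Filter
open scoped Pointwise

namespace IsConeFam

variable {n : ℕ} {X : Set (Euc n)} {𝒩 : Set (Euc n × Euc n)}

lemma mem_of_mem_coneFiber (h : IsConeFam X 𝒩) {x v : Euc n} (hv : v ∈ coneFiber 𝒩 x) :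
    x ∈ X :=
  (h.subset hv).1

lemma smul_mem_interior (h : IsConeFam X 𝒩) {x v : Euc n} {c : ℝ} (hc : 0 < c)
    (hv : v ∈ interior (coneFiber 𝒩 x)) : c • v ∈ interior (coneFiber 𝒩 x) := by
  have hx := h.mem_of_mem_coneFiber (interior_subset hv)
  have hsub : c • interior (coneFiber 𝒩 x) ⊆ coneFiber 𝒩 x := by
    rintro _ ⟨w, hw, rfl⟩
    exact (h.cone x hx).2.2.1 c hc.le w (interior_subset hw)
  exact interior_maximal hsub (isOpen_interior.smul₀ hc.ne') (smul_mem_smul_set hv)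

/-- The fiberwise interior of a cone family is jointly open. -/
lemma eventually_mem_interior (h : IsConeFam X 𝒩) {x v : Euc n}
    (hv : v ∈ interior (coneFiber 𝒩 x)) :
    ∀ᶠ p : Euc n × Euc n in 𝓝 (x, v), p.2 ∈ interior (coneFiber 𝒩 p.1) := by
  have hx := h.mem_of_mem_coneFiber (interior_subset hv)
  obtain ⟨b, hb, hbs⟩ := exists_mem_interior_convexHull_affineBasis
    (isOpen_interior.mem_nhds hv)
  have hev : ∀ᶠ y in 𝓝 x, ∀ i, b i ∈ interior (coneFiber 𝒩 y) := by
    refine eventually_all.2 fun i => ?_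
    obtain ⟨V, hVo, hxV, -, hV⟩ := h.lsc x hx (b i)
      (hbs (subset_convexHull ℝ _ (mem_range_self i)))
    exact mem_of_superset (hVo.mem_nhds hxV) hV
  have hev' : ∀ᶠ w in 𝓝 v, w ∈ interior (convexHull ℝ (range b)) :=
    isOpen_interior.mem_nhds hb
  rw [nhds_prod_eq]
  filter_upwards [hev.prod_mk hev'] with p hp
  have hp1 : p.1 ∈ X := h.mem_of_mem_coneFiber (interior_subset (hp.1 0))
  refine interior_mono (convexHull_min ?_ (h.cone _ hp1).2.1) hp.2
  rintro _ ⟨i, rfl⟩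
  exact interior_subset (hp.1 i)

/-- An open conic condition which holds on the nonzero vectors of one fiber holds on the nonzero
vectors of all nearby fibers. -/
lemma eventually_forall_coneFiber (h : IsConeFam X 𝒩) (hX : IsOpen X)
    {P : Euc n → Euc n → Prop} {x : Euc n} (hx : x ∈ X)
    (hP : ∀ v ∈ coneFiber 𝒩 x \ {0}, ∀ᶠ p : Euc n × Euc n in 𝓝 (x, v), P p.1 p.2)
    (hsmul : ∀ y v (c : ℝ), 0 < c → P y v → P y (c • v)) :
    ∀ᶠ y in 𝓝 x, ∀ v ∈ coneFiber 𝒩 y \ {0}, P y v := by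
  obtain ⟨C, hC, rfl⟩ := h.closed
  have key : ∀ᶠ y in 𝓝 x, ∀ v ∈ Metric.sphere (0 : Euc n) 1, (y, v) ∈ C → P y v := by
    refine (isCompact_sphere (0 : Euc n) 1).eventually_forall_of_forall_eventually
      fun v hv => ?_
    by_cases hvC : (x, v) ∈ C
    · filter_upwards [hP v ⟨⟨hvC, hx, trivial⟩, Metric.ne_of_mem_sphere hv one_ne_zero⟩] with p hp _
      exact hp
    · filter_upwards [hC.isOpen_compl.mem_nhds hvC] with p hp hp'
      exact absurd hp' hp
  filter_upwards [key, hX.mem_nhds hx] with y hy hyX v hv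
  have hv0 : 0 < ‖v‖ := norm_pos_iff.2 hv.2
  have hunit : ‖v‖⁻¹ • v ∈ Metric.sphere (0 : Euc n) 1 := by
    simp [norm_smul, hv0.ne']
  have hmem := (h.cone y hyX).2.2.1 ‖v‖⁻¹ (inv_nonneg.2 hv0.le) v hv.1
  simpa [smul_smul, hv0.ne'] using hsmul y _ ‖v‖ hv0 (hy _ hunit hmem.1)

lemma exists_ne_zero_mem_interior [Nontrivial (Euc n)] (h : IsConeFam X 𝒩) {x : Euc n}
    (hx : x ∈ X) : ∃ v ∈ interior (coneFiber 𝒩 x), v ≠ 0 := by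
  obtain ⟨v, hv⟩ := (h.cone x hx).2.2.2.1
  by_contra! h0
  have hnhds : ({0} : Set (Euc n)) ∈ 𝓝 v := mem_of_superset (isOpen_interior.mem_nhds hv) h0
  obtain rfl : v = 0 := h0 v hv
  exact not_isOpen_singleton (0 : Euc n) (isOpen_singleton_iff_nhds_eq_pure 0 |>.2
    (le_antisymm (le_pure_iff.2 hnhds) (pure_le_nhds 0)))

lemma restrict (h : IsConeFam X 𝒩) {V : Set (Euc n)} (hV : IsOpen V) (hVX : V ⊆ X) :
    IsConeFam V (coneRestrict 𝒩 V) := by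
  have hfib : ∀ y ∈ V, coneFiber (coneRestrict 𝒩 V) y = coneFiber 𝒩 y := fun y hy => by
    ext v; simp [coneFiber, coneRestrict, hy]
  refine ⟨inter_subset_right, ?_, fun y hy => ?_, fun y hy v hv => ?_⟩
  · obtain ⟨C, hC, rfl⟩ := h.closed
    refine ⟨C, hC, ?_⟩
    rw [coneRestrict, inter_assoc, inter_eq_self_of_subset_right (prod_mono_left hVX)]
  · rw [hfib y hy]; exact h.cone y (hVX hy)
  · rw [hfib y hy] at hv
    obtain ⟨W, hWo, hyW, -, hW⟩ := h.lsc y (hVX hy) v hv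
    refine ⟨W ∩ V, hWo.inter hV, ⟨hyW, hy⟩, inter_subset_right, fun z hz => ?_⟩
    rw [hfib z hz.2]
    exact hW z hz.1

lemma closure_interior_coneFiber (h : IsConeFam X 𝒩) {x : Euc n} (hx : x ∈ X) :
    closure (interior (coneFiber 𝒩 x)) = coneFiber 𝒩 x := by
  obtain ⟨hc, hconv, -, hne, -⟩ := h.cone x hx
  rw [hconv.closure_interior_eq_closure_of_nonempty_interior hne, hc.closure_eq]

/-- If `𝒩` is fiberwise contained in `𝒩'` over `S`, then also over the closure of `S` in `X`. -/
lemma coneFiber_subset_of_mem_closure (h : IsConeFam X 𝒩) {𝒩' : Set (Euc n × Euc n)}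
    (h' : IsConeFam X 𝒩') {S : Set (Euc n)}
    (hS : ∀ y ∈ S, coneFiber 𝒩 y ⊆ coneFiber 𝒩' y) {x : Euc n} (hx : x ∈ X)
    (hxS : x ∈ closure S) : coneFiber 𝒩 x ⊆ coneFiber 𝒩' x := by
  rw [← h.closure_interior_coneFiber hx]
  refine closure_minimal (fun v hv => ?_) (h'.cone x hx).1
  obtain ⟨V, hVo, hxV, -, hV⟩ := h.lsc x hx v hv
  obtain ⟨C, hC, rfl⟩ := h'.closed
  refine ⟨?_, hx, trivial⟩
  have hpre : IsClosed {y : Euc n | (y, v) ∈ C} := hC.preimage (by fun_prop)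
  refine closure_minimal (s := V ∩ S) (fun y hy => ?_) hpre
    (hVo.inter_closure ⟨hxV, hxS⟩)
  exact (hS y hy.2 (interior_subset (hV y hy.1))).1

end IsConeFam

lemma NOpen.restrict {n : ℕ} {X V U : Set (Euc n)} {𝒩 : Set (Euc n × Euc n)}
    (h : NOpen X 𝒩 U) (hV : IsOpen V) (hVX : V ⊆ X) :
    NOpen V (coneRestrict 𝒩 V) (U ∩ V) := by
  refine ⟨inter_subset_right, h.2.1.inter hV, fun γ γ' hγ h0 hγ' t ht => ⟨?_, hγ.maps t ht⟩⟩
  exact h.2.2 γ γ' ⟨fun s hs => hVX (hγ.maps s hs), hγ.deriv, hγ.cont⟩ h0.1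
    (fun s hs => ⟨(hγ' s hs).1.1, (hγ' s hs).2⟩) t ht

/-- Invariant sets are stable under adding a vector which lies in every fiber over the segment. -/
lemma NInvariant.add_mem {n : ℕ} {X P : Set (Euc n)} {𝒩 : Set (Euc n × Euc n)}
    (h : NInvariant X 𝒩 P) {y w : Euc n} (hy : y ∈ P)
    (hX : ∀ t ∈ Icc (0 : ℝ) 1, y + t • w ∈ X)
    (hw : ∀ t ∈ Icc (0 : ℝ) 1, w ∈ coneFiber 𝒩 (y + t • w) \ {0}) : y + w ∈ P := by
  have hd : ∀ t : ℝ, HasDerivAt (fun s : ℝ => y + s • w) w t := fun t => by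
    simpa using ((hasDerivAt_id t).smul_const w).const_add y
  simpa using h (fun s => y + s • w) (fun _ => w)
    ⟨hX, fun t _ => (hd t).hasDerivWithinAt, continuousOn_const⟩ (by simpa using hy) hw 1
    (right_mem_Icc.2 zero_le_one)

lemma NSpecial.subset_closure_interior {n : ℕ} {X Z : Set (Euc n)}
    {𝒩 : Set (Euc n × Euc n)} (hZ : NSpecial X 𝒩 Z) : Z ⊆ closure (interior Z) := by
  intro z hz
  rcases subsingleton_or_nontrivial (Euc n) with hs | hs
  · rw [(isOpen_discrete Z).interior_eq]
    exact subset_closure hz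
  obtain ⟨V, 𝒩', -, hzV, -, h𝒩', -, U₁, U₂, hU₁, hU₂, hU⟩ :=
    hZ.2 z ⟨subset_closure hz, hZ.1 hz⟩
  obtain ⟨v, hv, hv0⟩ := h𝒩'.exists_ne_zero_mem_interior hzV
  have hzU : z ∈ U₁ \ U₂ := hU ▸ ⟨hz, hzV⟩
  have hev : ∀ᶠ p : Euc n × Euc n in 𝓝 (z, v),
      p.1 ∈ U₁ ∧ p.2 ∈ coneFiber 𝒩' p.1 ∧ p.2 ≠ 0 := by
    filter_upwards [h𝒩'.eventually_mem_interior hv,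
      continuous_fst.continuousAt.eventually (hU₁.2.1.mem_nhds hzU.1),
      continuous_snd.continuousAt.eventually_ne hv0] with p h1 h2 h3
    exact ⟨h2, interior_subset h1, h3⟩
  obtain ⟨r, hr, hball⟩ := Metric.eventually_nhds_iff_ball.1 hev
  have hmem : ∀ᶠ ε : ℝ in 𝓝[>] 0, z - ε • v ∈ interior Z := by
    have hsmall : ∀ᶠ ε : ℝ in 𝓝[>] 0, ε * (‖v‖ + r) < r := by
      refine nhdsWithin_le_nhds (ContinuousAt.eventually_lt (by fun_prop) (by fun_prop) ?_)
      simpa using hr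
    filter_upwards [hsmall, self_mem_nhdsWithin] with ε hε hε0
    have hε0 : 0 < ε := hε0
    refine mem_interior.2 ⟨(fun p => ε⁻¹ • (z - p)) ⁻¹' Metric.ball v r, fun p hp => ?_,
      Metric.isOpen_ball.preimage (by fun_prop), ?_⟩
    · obtain ⟨w, rfl⟩ : ∃ w, p = z - ε • w :=
        ⟨ε⁻¹ • (z - p), by rw [smul_inv_smul₀ hε0.ne', sub_sub_cancel]⟩
      have hw : w ∈ Metric.ball v r := by simpa [hε0.ne'] using hp
      have hwn : ‖w‖ < ‖v‖ + r := by
        have := norm_le_norm_add_norm_sub' w v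
        rw [mem_ball_iff_norm] at hw
        linarith
      have hseg : ∀ t ∈ Icc (0 : ℝ) 1, z - ε • w + t • ε • w ∈ U₁ ∧
          w ∈ coneFiber 𝒩' (z - ε • w + t • ε • w) ∧ w ≠ 0 := fun t ht => by
        refine hball (_, w) ?_
        rw [← ball_prod_same]
        refine ⟨?_, hw⟩
        have heq : z - ε • w + t • ε • w - z = -(((1 - t) * ε) • w) := by module
        have h1 : 0 ≤ 1 - t := by linarith [ht.2]
        rw [mem_ball_iff_norm, heq, norm_neg, norm_smul, Real.norm_of_nonneg (by positivity)]
        calc (1 - t) * ε * ‖w‖ ≤ 1 * ε * ‖w‖ := by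
              gcongr
              linarith [ht.1]
          _ ≤ ε * (‖v‖ + r) := by
              rw [one_mul]
              gcongr
          _ < r := hε
      have hmem : z - ε • w ∈ U₁ \ U₂ := by
        refine ⟨by simpa using (hseg 0 (by simp)).1, fun hU₂' => hzU.2 ?_⟩
        have := hU₂.2.2.add_mem (w := ε • w) hU₂' (fun t ht => hU₁.1 (hseg t ht).1)
          (fun t ht => ⟨(h𝒩'.cone _ (hU₁.1 (hseg t ht).1)).2.2.1 ε hε0.le w (hseg t ht).2.1,
            smul_ne_zero hε0.ne' (hseg t ht).2.2⟩)
        rwa [sub_add_cancel] at this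
      exact (hU.symm ▸ hmem : z - ε • w ∈ Z ∩ V).1
    · simp [hε0.ne', hr]
  have hlim : Tendsto (fun ε : ℝ => z - ε • v) (𝓝[>] 0) (𝓝 z) := by
    have : Continuous fun ε : ℝ => z - ε • v := by fun_prop
    simpa using (this.tendsto 0).mono_left nhdsWithin_le_nhds
  exact mem_closure_of_tendsto hlim hmem

/-- being `𝒩`-special (resp. an `𝒩`-lens) only depends on the cone
family over `Int(Z)`. -/
theorem stmt_11 {n : ℕ} (X : Set (Euc n)) (hX : IsOpen X)
    (𝒩 : Set (Euc n × Euc n)) (h𝒩 : IsConeFam X 𝒩)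
    (Z : Set (Euc n)) (hZ : NSpecial X 𝒩 Z)
    (𝒩t : Set (Euc n × Euc n)) (h𝒩t : IsConeFam X 𝒩t)
    (heq : ∀ x ∈ interior Z, coneFiber 𝒩t x = coneFiber 𝒩 x) :
    NSpecial X 𝒩t Z ∧ (NLens X 𝒩 Z → NLens X 𝒩t Z) := by
  have hsub : ∀ x ∈ closure Z ∩ X, coneFiber 𝒩t x ⊆ coneFiber 𝒩 x := fun x hx =>
    h𝒩t.coneFiber_subset_of_mem_closure h𝒩 (fun y hy => (heq y hy).subset) hx.2
      (closure_minimal hZ.subset_closure_interior isClosed_closure hx.1)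
  have hspecial : NSpecial X 𝒩t Z := by
    refine ⟨hZ.1, fun x hx => ?_⟩
    obtain ⟨V, 𝒩', hV, hxV, hVX, h𝒩', hlt, U₁, U₂, hU₁, hU₂, hU⟩ := hZ.2 x hx
    have hev := h𝒩t.eventually_forall_coneFiber hX hx.2
      (P := fun y v => v ∈ interior (coneFiber 𝒩' y))
      (fun v hv => h𝒩'.eventually_mem_interior
        (hlt x hxV ⟨⟨hsub x hx hv.1, hxV, trivial⟩, hv.2⟩))
      (fun y v c hc hv => h𝒩'.smul_mem_interior hc hv)
    obtain ⟨W, hW, hWo, hxW⟩ := eventually_nhds_iff.1 (hev.and (hV.mem_nhds hxV))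
    have hWV : W ⊆ V := fun y hy => (hW y hy).2
    refine ⟨W, coneRestrict 𝒩' W, hWo, hxW, hWV.trans hVX, h𝒩'.restrict hWo hWV, ?_,
      U₁ ∩ W, U₂ ∩ W, hU₁.restrict hWo hWV, hU₂.restrict hWo hWV, ?_⟩
    · intro y hy v hv
      have hfib : coneFiber (coneRestrict 𝒩' W) y = coneFiber 𝒩' y := by
        ext w; simp [coneFiber, coneRestrict, hy]
      rw [hfib]
      exact (hW y hy).1 v ⟨hv.1.1, hv.2⟩
    · rw [← inter_sdiff_distrib_right, ← hU, inter_assoc, inter_eq_self_of_subset_right hWV]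
  refine ⟨hspecial, fun hlens => ⟨hspecial, hlens.2.1, ?_⟩⟩
  obtain ⟨W, f, hW, hZW, hWX, df, hdf, hder, hneg⟩ := hlens.2.2
  refine ⟨interior {y | y ∈ W ∧ ∀ τ ∈ coneFiber 𝒩t y \ {0}, df y τ < 0}, f, isOpen_interior,
    fun x hx => ?_, fun y hy => hWX (interior_subset hy).1, df,
    hdf.mono fun y hy => (interior_subset hy).1, fun y hy => hder y (interior_subset hy).1,
    fun y hy => (interior_subset hy).2⟩
  refine mem_interior_iff_mem_nhds.2 (Filter.Eventually.and (hW.mem_nhds (hZW hx)) ?_)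
  refine h𝒩t.eventually_forall_coneFiber hX hx.2 (P := fun y τ => df y τ < 0)
    (fun v hv => ?_) (fun y v c hc hv => ?_)
  · have hcont : ContinuousAt (fun p : Euc n × Euc n => df p.1 p.2) (x, v) :=
      (ContinuousAt.comp (x := (x, v)) (f := Prod.fst)
        (hdf.continuousAt (hW.mem_nhds (hZW hx))) continuousAt_fst).clm_apply continuousAt_snd
    exact hcont.eventually_lt continuousAt_const (hneg x (hZW hx) v ⟨hsub x hx hv.1, hv.2⟩)
  · rw [map_smul, smul_eq_mul]
    exact mul_neg_of_pos_of_neg hc hv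
end
end
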